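/- arXiv:2511.03885 — 3 statements merged into one kernel-verified Lean document; each statement's English description precedes it below -/
import Mathlib

section
/- Let (β_1,β_2,β_3) be a PBW sequence for Gr(3,4), σ ∈ S_3, and let S and S_σ be iterated sequences for Gr(3,n) with identical iteration triples, where S is iterated from (β_1,β_2,β_3) and S_σ from (β_{σ(1)},β_{σ(2)},β_{σ(3)}). If a ℤ-linear map e_S : ℤ^{3(n−3)} → ℤ preserves inequalities with respect to S, then there exists a ℤ-linear map e_{S_σ} : ℤ^{3(n−3)} → ℤ that preserves inequalities with respect to S_σ and satisfies e_{S_σ}(v_{S_σ}(p̄_K)) = e_S(v_S(p̄_K)) for every K ∈ I_{3,n} (i.e. e_{S_σ}M_{S_σ} = e_S M_S). -/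
/-!
Common framework: iterated sequences for Gr(3,n), the matrix `A_S`, pullbacks of
Plücker coordinates, the weighted reverse lexicographic order, lowest-term
valuations, Plücker relations, weighting matrices and initial ideals.
-/

open MvPolynomial

noncomputable section

/-- Height of a positive root `(i,j) ↦ j - i`. -/
def Ht (β : ℕ × ℕ) : ℕ := β.2 - β.1

/-- `IsIter n S` : `S` is an iterated sequence for `Gr(3,n)`: it starts (as base of the
iteration) from a PBW sequence for `Gr(3,4)`, i.e. an ordering of `((1,4),(2,4),(3,4))`,
and for each `r = 5, …, n` a triple `((i₁,r),(i₂,r),(i₃,r))` with `i₁,i₂,i₃ ∈ [r-1]`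
pairwise distinct is prepended. -/
inductive IsIter : ℕ → List (ℕ × ℕ) → Prop
  | base (L : List (ℕ × ℕ)) : L.Perm [(1,4),(2,4),(3,4)] → IsIter 4 L
  | step (r : ℕ) (L : List (ℕ × ℕ)) (i₁ i₂ i₃ : ℕ) :
      4 ≤ r → IsIter r L →
      1 ≤ i₁ → i₁ ≤ r → 1 ≤ i₂ → i₂ ≤ r → 1 ≤ i₃ → i₃ ≤ r →
      i₁ ≠ i₂ → i₁ ≠ i₃ → i₂ ≠ i₃ →
      IsIter (r+1) ((i₁, r+1) :: (i₂, r+1) :: (i₃, r+1) :: L)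

/-- `Sorted k n I` : `I ∈ I_{k,n}`, a strictly increasing `k`-tuple in `{1,…,n}`. -/
def Sorted (k n : ℕ) (I : Fin k → ℕ) : Prop :=
  StrictMono I ∧ ∀ a, 1 ≤ I a ∧ I a ≤ n

/-- `ℕ`-indexed square "matrices" (1-based indexing, size given by a parameter `n`). -/
abbrev NMat := ℕ → ℕ → MvPolynomial (ℕ × ℕ) ℂ

/-- Product of two `n × n` matrices, 1-based indexing. -/
def matMul (n : ℕ) (A B : NMat) : NMat := fun i j => ∑ k ∈ Finset.Icc 1 n, A i k * B k j

/-- Identity matrix. -/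
def idN : NMat := fun i j => if i = j then 1 else 0

/-- The factor `1 + x_β f_β`, where `f_β` is the matrix unit in entry `β = (i,j)`. -/
def factor (β : ℕ × ℕ) : NMat := fun i j =>
  (if i = j then (1 : MvPolynomial (ℕ × ℕ) ℂ) else 0) +
    (if i = β.1 ∧ j = β.2 then (MvPolynomial.X β : MvPolynomial (ℕ × ℕ) ℂ) else 0)

/-- `A_S := (1 + x_{β_N} f_{β_N}) ⋯ (1 + x_{β_1} f_{β_1})` for `S = (β_1, …, β_N)`. -/
def ASmat (n : ℕ) : List (ℕ × ℕ) → NMat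
  | [] => idN
  | β :: L => matMul n (ASmat n L) (factor β)

/-- `φ_S^*(p̄_I)` : the determinant of the `3×3` submatrix of `A_S` on rows `(1,2,3)`
and columns `I = (i₁,i₂,i₃)`. -/
def phiStar (n : ℕ) (S : List (ℕ × ℕ)) (I : Fin 3 → ℕ) : MvPolynomial (ℕ × ℕ) ℂ :=
  Matrix.det (Matrix.of fun a b : Fin 3 => ASmat n S (a.val + 1) (I b))

/-- `Ψ_S(a) = Σ_l a_l Ht(β_l)`, the height-weighted function (written on exponents). -/
def Psi (d : (ℕ × ℕ) →₀ ℕ) : ℕ := d.sum fun β c => c * Ht β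

/-- `a <_lex b` : lexicographic comparison of exponent vectors, the coordinates being
read in the order `β_1, …, β_N` of the sequence `S`. -/
def lexLT (S : List (ℕ × ℕ)) (a b : (ℕ × ℕ) →₀ ℕ) : Prop :=
  ∃ k < S.length, (∀ m < k, a (S.getD m (0,0)) = b (S.getD m (0,0))) ∧
    a (S.getD k (0,0)) < b (S.getD k (0,0))

/-- `a ≤_lex b` on coordinates indexed by `S`. -/
def lexLE (S : List (ℕ × ℕ)) (a b : (ℕ × ℕ) →₀ ℕ) : Prop :=
  lexLT S a b ∨ ∀ k < S.length, a (S.getD k (0,0)) = b (S.getD k (0,0))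

/-- `a ≺_{Ψ_S} b` : the strict `Ψ_S`-weighted reverse lexicographic order:
`Ψ_S(a) < Ψ_S(b)`, or `Ψ_S(a) = Ψ_S(b)` and `a >_lex b`. -/
def psiLT (S : List (ℕ × ℕ)) (a b : (ℕ × ℕ) →₀ ℕ) : Prop :=
  Psi a < Psi b ∨ (Psi a = Psi b ∧ lexLT S b a)

/-- `a ⪯_{Ψ_S} b`. -/
def psiLE (S : List (ℕ × ℕ)) (a b : (ℕ × ℕ) →₀ ℕ) : Prop :=
  Psi a < Psi b ∨ (Psi a = Psi b ∧ lexLE S b a)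

open scoped Classical in
/-- The `⪯_{Ψ_S}`-minimum of the support of a polynomial (defaulting to `0` if no
minimum exists). -/
def minSupp (S : List (ℕ × ℕ)) (f : MvPolynomial (ℕ × ℕ) ℂ) : (ℕ × ℕ) →₀ ℕ :=
  if h : ∃ m ∈ f.support, ∀ m' ∈ f.support, psiLE S m m' then h.choose else 0

/-- The lowest-term valuation `v_S(p̄_I)` : the `⪯_{Ψ_S}`-minimum of the support of
`φ_S^*(p̄_I)`. -/
def valS (n : ℕ) (S : List (ℕ × ℕ)) (I : Fin 3 → ℕ) : (ℕ × ℕ) →₀ ℕ :=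
  minSupp S (phiStar n S I)

/-- The index set `I_{3,n}` of Plücker variables. -/
abbrev MI (n : ℕ) := {v : Fin 3 → ℕ // Sorted 3 n v}

/-- The Plücker polynomial ring `ℂ[p_K : K ∈ I_{3,n}]`. -/
abbrev PRing (n : ℕ) := MvPolynomial (MI n) ℂ

open scoped Classical in
/-- The Plücker variable `p_K`, defined to be `0` if `K` is not strictly increasing
(in particular `p_{I ∪ j} = 0` if `j ∈ I`). -/
def pvar (n : ℕ) (K : Fin 3 → ℕ) : PRing n :=
  if h : Sorted 3 n K then MvPolynomial.X (⟨K, h⟩ : MI n) else 0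

/-- `I ∪ j` : the sorted triple obtained by adjoining `j` to the pair `I`. -/
def insert3 (I : Fin 2 → ℕ) (j : ℕ) : Fin 3 → ℕ :=
  fun a => (List.insertionSort (· ≤ ·) [I 0, I 1, j]).getD a 0

/-- `J ∖ j` : the sorted triple obtained by removing `j` from the 4-tuple `J`. -/
def erase4 (J : Fin 4 → ℕ) (j : ℕ) : Fin 3 → ℕ :=
  fun a => (([J 0, J 1, J 2, J 3]).erase j).getD a 0

/-- The Plücker relation
`R_{I,J} = Σ_{j ∈ J} (−1)^{#{i∈I : i<j} + #{j'∈J : j<j'}} p_{I∪j} p_{J∖j}`. -/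
def Rrel (n : ℕ) (I : Fin 2 → ℕ) (J : Fin 4 → ℕ) : PRing n :=
  ∑ a : Fin 4,
    (-1 : PRing n) ^ ((Finset.univ.filter fun b : Fin 2 => I b < J a).card +
        (Finset.univ.filter fun b : Fin 4 => J a < J b).card) *
      (pvar n (insert3 I (J a)) * pvar n (erase4 J (J a)))

/-- The Plücker ideal `𝓘_{3,n}`, generated by all Plücker relations. -/
def PluckerIdeal (n : ℕ) : Ideal (PRing n) :=
  Ideal.span {f | ∃ I J, Sorted 2 n I ∧ Sorted 4 n J ∧ f = Rrel n I J}

/-- `M_S · m = Σ_K m_K v_S(p̄_K)` : the weighting matrix applied to an exponent. -/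
def MSdot (n : ℕ) (S : List (ℕ × ℕ)) (m : MI n →₀ ℕ) : (ℕ × ℕ) →₀ ℕ :=
  m.sum fun K c => c • valS n S K.val

open scoped Classical in
/-- The initial form `In_{M_S}(f)` : the sum of the terms of `f` whose `M_S`-weight is
`⪯_{Ψ_S}`-minimal. -/
def inM (n : ℕ) (S : List (ℕ × ℕ)) (f : PRing n) : PRing n :=
  ∑ m ∈ f.support.filter fun m => ∀ m' ∈ f.support, psiLE S (MSdot n S m) (MSdot n S m'),
    MvPolynomial.monomial m (f.coeff m)

/-- The initial ideal `In_{M_S}(𝓘_{3,n}) = ⟨In_{M_S}(g) : g ∈ 𝓘_{3,n}, g ≠ 0⟩`. -/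
def InIdeal (n : ℕ) (S : List (ℕ × ℕ)) : Ideal (PRing n) :=
  Ideal.span {g | ∃ f, f ∈ PluckerIdeal n ∧ f ≠ 0 ∧ g = inM n S f}

/-- Evaluation of the `ℤ`-linear functional with coefficients `c` on an exponent
vector (i.e. an element `e ∈ (ℤ^{3(n-3)})^*` given by its coefficients). -/
def evalF (c : ℕ × ℕ → ℤ) (d : (ℕ × ℕ) →₀ ℕ) : ℤ := d.sum fun β m => c β * (m : ℤ)

/-- `v_S(p̄_{I∪j}) + v_S(p̄_{J∖j})`, the `M_S`-weight of the term of `R_{I,J}`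
corresponding to `j = J a`. -/
def wvec (n : ℕ) (S : List (ℕ × ℕ)) (I : Fin 2 → ℕ) (J : Fin 4 → ℕ) (a : Fin 4) :
    (ℕ × ℕ) →₀ ℕ :=
  valS n S (insert3 I (J a)) + valS n S (erase4 J (J a))

/-- A `ℤ`-linear functional `e` (given by its coefficients `c`) *preserves inequalities*
with respect to `S` if for every nonzero Plücker relation `R_{I,J}` and all
`s₁, s₂ ∈ J ∖ I`, `v_S(p̄_{I∪s₁}) + v_S(p̄_{J∖s₁}) ≺_{Ψ_S} v_S(p̄_{I∪s₂}) + v_S(p̄_{J∖s₂})`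
implies the corresponding strict inequality of the values of `e`. -/
def PreservesIneq (n : ℕ) (S : List (ℕ × ℕ)) (c : ℕ × ℕ → ℤ) : Prop :=
  ∀ (I : Fin 2 → ℕ) (J : Fin 4 → ℕ), Sorted 2 n I → Sorted 4 n J → Rrel n I J ≠ 0 →
    ∀ a b : Fin 4, (∀ t : Fin 2, I t ≠ J a) → (∀ t : Fin 2, I t ≠ J b) →
      psiLT S (wvec n S I J a) (wvec n S I J b) →
      evalF c (wvec n S I J a) < evalF c (wvec n S I J b)

end

lemma matMul_factor (n : ℕ) (M : NMat) (β : ℕ × ℕ) (i j : ℕ) :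
    matMul n M (factor β) i j = (if j ∈ Finset.Icc 1 n then M i j else 0) +
      if β.1 ∈ Finset.Icc 1 n ∧ j = β.2 then M i β.1 * X β else 0 := by
  have h (k : ℕ) : M i k * factor β k j =
      (if k = j then M i k else 0) + if k = β.1 then (if j = β.2 then M i k * X β else 0) else 0 := by
    unfold factor
    split_ifs <;> simp_all [mul_add]
  simp only [matMul, h, Finset.sum_add_distrib, Finset.sum_ite_eq', ite_and]

lemma ASmat_append_congr (n : ℕ) (T : List (ℕ × ℕ)) {L L' : List (ℕ × ℕ)}
    (h : ASmat n L = ASmat n L') : ASmat n (T ++ L) = ASmat n (T ++ L') := by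
  induction T with
  | nil => exact h
  | cons β T ih => simp only [List.cons_append, ASmat, ih]

/-- Factors whose roots lie in a common column, and not in a row of that index, commute. -/
lemma ASmat_perm {n r : ℕ} (hr : r ∈ Finset.Icc 1 n) {L L' : List (ℕ × ℕ)} (hp : L.Perm L')
    (hL : ∀ β ∈ L, β.2 = r ∧ β.1 ≠ r) : ASmat n L = ASmat n L' := by
  induction hp with
  | nil => rfl
  | cons β _ ih => simp only [ASmat, ih fun γ hγ => hL γ (List.mem_cons_of_mem _ hγ)]
  | swap β γ L =>
    have hβ := hL β (by simp)
    have hγ := hL γ (by simp)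
    funext i j
    simp only [ASmat, matMul_factor, hβ.1, hγ.1, hβ.2, hγ.2, and_false, if_false, add_zero]
    by_cases hj : j = r
    · subst hj
      simp only [hr, if_true, and_true]
      split_ifs <;> ring
    · simp [hj]
  | trans h₁ _ ih₁ ih₂ => exact (ih₁ hL).trans (ih₂ fun β hβ => hL β (h₁.mem_iff.2 hβ))

/-- The `k`-th coordinate of the torus weight for which entry `(i,j)` of `A_S` is homogeneous. -/
def torusWeight (k : ℕ) (β : ℕ × ℕ) : ℤ :=
  (if β.1 = k then 1 else 0) - if β.2 = k then 1 else 0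

lemma torusWeight_add (k i j l : ℕ) :
    torusWeight k (i, j) + torusWeight k (j, l) = torusWeight k (i, l) := by
  simp [torusWeight]

lemma isWeightedHomogeneous_factor (k : ℕ) (β : ℕ × ℕ) (i j : ℕ) :
    IsWeightedHomogeneous (torusWeight k) (factor β i j) (torusWeight k (i, j)) := by
  refine IsWeightedHomogeneous.add ?_ ?_
  · split_ifs with h
    · subst h
      simpa [torusWeight] using isWeightedHomogeneous_one ℂ (torusWeight k)
    · exact isWeightedHomogeneous_zero _ _ _
  · split_ifs with h
    · obtain ⟨rfl, rfl⟩ := h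
      exact isWeightedHomogeneous_X _ _ _
    · exact isWeightedHomogeneous_zero _ _ _

lemma isWeightedHomogeneous_ASmat (k n : ℕ) (S : List (ℕ × ℕ)) (i j : ℕ) :
    IsWeightedHomogeneous (torusWeight k) (ASmat n S i j) (torusWeight k (i, j)) := by
  induction S generalizing j with
  | nil =>
    simp only [ASmat, idN]
    split_ifs with h
    · subst h
      simpa [torusWeight] using isWeightedHomogeneous_one ℂ (torusWeight k)
    · exact isWeightedHomogeneous_zero _ _ _
  | cons β S ih =>
    refine IsWeightedHomogeneous.sum _ _ _ fun l _ => ?_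
    rw [← torusWeight_add k i l j]
    exact (ih l).mul (isWeightedHomogeneous_factor k β l j)

lemma isWeightedHomogeneous_phiStar (k n : ℕ) (S : List (ℕ × ℕ)) (K : Fin 3 → ℕ) :
    IsWeightedHomogeneous (torusWeight k) (phiStar n S K)
      (∑ a : Fin 3, torusWeight k (a.val + 1, K a)) := by
  rw [phiStar, Matrix.det_apply]
  refine IsWeightedHomogeneous.sum _ _ _ fun σ _ => ?_
  have h := IsWeightedHomogeneous.prod Finset.univ
    (fun a : Fin 3 => ASmat n S ((σ a).val + 1) (K a)) _
    (fun a _ => isWeightedHomogeneous_ASmat k n S ((σ a).val + 1) (K a))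
  have hs : ∑ a : Fin 3, torusWeight k ((σ a).val + 1, K a) =
      ∑ a : Fin 3, torusWeight k (a.val + 1, K a) := by
    simp only [torusWeight, Finset.sum_sub_distrib]
    rw [Equiv.sum_comp σ fun a : Fin 3 => if a.val + 1 = k then (1 : ℤ) else 0]
  rw [hs] at h
  rcases Int.units_eq_one_or (Equiv.Perm.sign σ) with h' | h' <;> rw [h']
  · simpa using h
  · rw [Units.neg_smul, one_smul]
    exact (weightedHomogeneousSubmodule ℂ (torusWeight k) _).neg_mem h

lemma ASmat_mem_supported (n : ℕ) (S : List (ℕ × ℕ)) (i j : ℕ) :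
    ASmat n S i j ∈ supported ℂ {β | β ∈ S} := by
  induction S generalizing j with
  | nil =>
    simp only [ASmat, idN]
    split_ifs
    · exact one_mem _
    · exact zero_mem _
  | cons β S ih =>
    have h (l : ℕ) : ASmat n S i l ∈ supported ℂ {γ | γ ∈ β :: S} :=
      supported_mono (fun γ hγ => List.mem_cons_of_mem _ hγ) (ih l)
    rw [ASmat, matMul_factor]
    refine add_mem ?_ ?_
    · split_ifs
      · exact h j
      · exact zero_mem _
    · split_ifs
      · exact mul_mem (h _) (X_mem_supported.2 (by simp))
      · exact zero_mem _

lemma phiStar_mem_supported (n : ℕ) (S : List (ℕ × ℕ)) (K : Fin 3 → ℕ) :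
    phiStar n S K ∈ supported ℂ {β | β ∈ S} := by
  rw [phiStar, Matrix.det_apply]
  refine sum_mem fun σ _ => ?_
  rw [Units.smul_def]
  exact zsmul_mem (prod_mem fun a _ => ASmat_mem_supported n S _ _) _

lemma mem_of_mem_support_phiStar {n : ℕ} {S : List (ℕ × ℕ)} {K : Fin 3 → ℕ}
    {d : (ℕ × ℕ) →₀ ℕ} (hd : d ∈ (phiStar n S K).support) {β : ℕ × ℕ} (hβ : d β ≠ 0) : β ∈ S :=
  (mem_supported.1 (phiStar_mem_supported n S K))
    (mem_vars_iff_mem_support β |>.2 ⟨d, hd, Finsupp.mem_support_iff.2 hβ⟩)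

lemma IsIter.exists_append {n : ℕ} {S : List (ℕ × ℕ)} (h : IsIter n S) :
    (∃ T L, S = T ++ L ∧ T.length = 3 * (n - 4) ∧ L.Perm [(1, 4), (2, 4), (3, 4)]) ∧
      ∀ β ∈ S, β.2 ≤ n := by
  induction h with
  | base L hL =>
    refine ⟨⟨[], L, rfl, by simp, hL⟩, fun β hβ => ?_⟩
    have := hL.mem_iff.1 hβ
    simp only [List.mem_cons, List.not_mem_nil, or_false] at this
    rcases this with rfl | rfl | rfl <;> simp
  | step r L i₁ i₂ i₃ hr _ _ _ _ _ _ _ _ _ _ ih =>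
    obtain ⟨⟨T, L₀, rfl, hT, hL₀⟩, hb⟩ := ih
    refine ⟨⟨(i₁, r + 1) :: (i₂, r + 1) :: (i₃, r + 1) :: T, L₀, rfl, ?_, hL₀⟩, fun β hβ => ?_⟩
    · simp only [List.length_cons]
      omega
    · simp only [List.mem_cons] at hβ
      rcases hβ with rfl | rfl | rfl | hβ
      · simp
      · simp
      · simp
      · exact (hb β hβ).trans (Nat.le_succ r)

/-- Exponents of equal torus weight on an iterated sequence are determined by their coordinates
on the iteration triples. -/
lemma eq_of_weight_eq {T L : List (ℕ × ℕ)} (hL : L.Perm [(1, 4), (2, 4), (3, 4)])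
    {d₁ d₂ : (ℕ × ℕ) →₀ ℕ}
    (h₁ : ∀ β, d₁ β ≠ 0 → β ∈ T ++ L) (h₂ : ∀ β, d₂ β ≠ 0 → β ∈ T ++ L)
    (hw : ∀ k, Finsupp.weight (torusWeight k) d₁ = Finsupp.weight (torusWeight k) d₂)
    (h : ∀ β ∈ T, d₁ β = d₂ β) : d₁ = d₂ := by
  ext β
  by_cases hβT : β ∈ T
  · exact h β hβT
  by_cases hβL : β ∈ L
  · have hβ : β.2 = 4 ∧ β.1 < 4 := by
      have := hL.mem_iff.1 hβL
      simp only [List.mem_cons, List.not_mem_nil, or_false] at this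
      rcases this with rfl | rfl | rfl <;> simp
    have hk := hw β.1
    rw [Finsupp.weight_apply, Finsupp.weight_apply,
      Finsupp.sum_of_support_subset d₁ (Finset.subset_union_left (s₂ := d₂.support)) _ (by simp),
      Finsupp.sum_of_support_subset d₂ (Finset.subset_union_right (s₁ := d₁.support)) _ (by simp),
      ← sub_eq_zero, ← Finset.sum_sub_distrib, Finset.sum_eq_single β] at hk
    · have hwβ : torusWeight β.1 β = 1 := by
        simp [torusWeight, hβ.1, hβ.2.ne']
      rw [hwβ] at hk
      simp only [nsmul_eq_mul, mul_one] at hk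
      omega
    · intro γ hγ hne
      have hγS : γ ∈ T ++ L := by
        rcases Finset.mem_union.1 hγ with hγ | hγ
        · exact h₁ γ (Finsupp.mem_support_iff.1 hγ)
        · exact h₂ γ (Finsupp.mem_support_iff.1 hγ)
      rcases List.mem_append.1 hγS with hγ | hγ
      · rw [h γ hγ, sub_self]
      · have hγ4 : γ.2 = 4 := by
          have := hL.mem_iff.1 hγ
          simp only [List.mem_cons, List.not_mem_nil, or_false] at this
          rcases this with rfl | rfl | rfl <;> rfl
        have hne' : γ.1 ≠ β.1 := fun e => hne (Prod.ext e (hγ4.trans hβ.1.symm))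
        simp [torusWeight, hγ4, hne', hβ.2.ne']
    · intro hβ'
      rw [Finset.mem_union, not_or, Finsupp.notMem_support_iff, Finsupp.notMem_support_iff] at hβ'
      simp [hβ'.1, hβ'.2]
  · have hβ : β ∉ T ++ L := by simp [hβT, hβL]
    rw [not_ne_iff.1 (mt (h₁ β) hβ), not_ne_iff.1 (mt (h₂ β) hβ)]

lemma eq_on_of_getD_eq {S : List (ℕ × ℕ)} {d₁ d₂ : (ℕ × ℕ) →₀ ℕ}
    (h : ∀ k < S.length, d₁ (S.getD k (0, 0)) = d₂ (S.getD k (0, 0))) :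
    ∀ β ∈ S, d₁ β = d₂ β := by
  intro β hβ
  obtain ⟨k, hk, rfl⟩ := List.mem_iff_getElem.1 hβ
  have := h k hk
  rwa [List.getD_eq_getElem _ _ hk] at this

lemma lexLT_append {T L : List (ℕ × ℕ)} (L' : List (ℕ × ℕ)) {d₁ d₂ : (ℕ × ℕ) →₀ ℕ}
    (hd : (∀ β ∈ T, d₁ β = d₂ β) → d₁ = d₂) (h : lexLT (T ++ L) d₁ d₂) :
    lexLT (T ++ L') d₁ d₂ := by
  obtain ⟨k, -, heq, hlt⟩ := h
  rcases lt_or_ge k T.length with hk | hk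
  · refine ⟨k, by simp; omega, fun m hm => ?_, ?_⟩
    · have := heq m hm
      rwa [List.getD_append _ _ _ _ (hm.trans hk)] at this ⊢
    · rwa [List.getD_append _ _ _ _ hk] at hlt ⊢
  · have := hd (eq_on_of_getD_eq fun m hm => by
      have := heq m (hm.trans_le hk)
      rwa [List.getD_append _ _ _ _ hm] at this)
    simp [this] at hlt

lemma lexLE_append {T L : List (ℕ × ℕ)} (L' : List (ℕ × ℕ)) {d₁ d₂ : (ℕ × ℕ) →₀ ℕ}
    (hd : (∀ β ∈ T, d₁ β = d₂ β) → d₁ = d₂) (h : lexLE (T ++ L) d₁ d₂) :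
    lexLE (T ++ L') d₁ d₂ := by
  rcases h with h | h
  · exact Or.inl (lexLT_append L' hd h)
  · have := hd fun β hβ => eq_on_of_getD_eq h β (List.mem_append_left _ hβ)
    exact Or.inr fun k _ => by rw [this]

lemma psiLT_append_iff {T : List (ℕ × ℕ)} (L L' : List (ℕ × ℕ)) {d₁ d₂ : (ℕ × ℕ) →₀ ℕ}
    (hd : (∀ β ∈ T, d₂ β = d₁ β) → d₂ = d₁) :
    psiLT (T ++ L) d₁ d₂ ↔ psiLT (T ++ L') d₁ d₂ :=
  or_congr_right <| and_congr_right fun _ => ⟨lexLT_append L' hd, lexLT_append L hd⟩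

lemma psiLE_append_iff {T : List (ℕ × ℕ)} (L L' : List (ℕ × ℕ)) {d₁ d₂ : (ℕ × ℕ) →₀ ℕ}
    (hd : (∀ β ∈ T, d₂ β = d₁ β) → d₂ = d₁) :
    psiLE (T ++ L) d₁ d₂ ↔ psiLE (T ++ L') d₁ d₂ :=
  or_congr_right <| and_congr_right fun _ => ⟨lexLE_append L' hd, lexLE_append L hd⟩

lemma minSupp_congr {S S' : List (ℕ × ℕ)} {f : MvPolynomial (ℕ × ℕ) ℂ}
    (h : ∀ m ∈ f.support, ∀ m' ∈ f.support, psiLE S m m' ↔ psiLE S' m m') :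
    minSupp S f = minSupp S' f := by
  have : (fun m => m ∈ f.support ∧ ∀ m' ∈ f.support, psiLE S m m') =
      fun m => m ∈ f.support ∧ ∀ m' ∈ f.support, psiLE S' m m' := by
    funext m
    exact propext (and_congr_right fun hm => forall₂_congr fun m' hm' => h m hm m' hm')
  classical
  have hchoose (P Q : ((ℕ × ℕ) →₀ ℕ) → Prop) (hPQ : P = Q) :
      (if h : ∃ m, P m then h.choose else 0) = if h : ∃ m, Q m then h.choose else 0 := by
    subst hPQ
    rfl
  unfold minSupp
  convert hchoose _ _ this

/-- The linear order underlying `psiLE`. -/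
def psiKey (S : List (ℕ × ℕ)) (d : (ℕ × ℕ) →₀ ℕ) :
    ℕ ×ₗ (Lex (Fin S.length → ℕ))ᵒᵈ :=
  toLex (Psi d, OrderDual.toDual (toLex fun k => d (S.getD k (0, 0))))

lemma psiLE_of_psiKey_le {S : List (ℕ × ℕ)} {d₁ d₂ : (ℕ × ℕ) →₀ ℕ}
    (h : psiKey S d₁ ≤ psiKey S d₂) : psiLE S d₁ d₂ := by
  rcases Prod.Lex.toLex_le_toLex.1 h with h | ⟨h, h'⟩
  · exact Or.inl h
  · refine Or.inr ⟨h, ?_⟩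
    rcases (OrderDual.toDual_le_toDual.1 h').lt_or_eq with h' | h'
    · obtain ⟨k, heq, hlt⟩ := h'
      exact Or.inl ⟨k, k.2, fun m hm => heq ⟨m, hm.trans k.2⟩ hm, hlt⟩
    · exact Or.inr fun k hk => congrFun (toLex_inj.1 h') ⟨k, hk⟩

lemma minSupp_mem_support (S : List (ℕ × ℕ)) {f : MvPolynomial (ℕ × ℕ) ℂ} (hf : f ≠ 0) :
    minSupp S f ∈ f.support := by
  have h : ∃ m ∈ f.support, ∀ m' ∈ f.support, psiLE S m m' := by
    obtain ⟨m, hm, hmin⟩ := f.support.exists_min_image (psiKey S) (support_nonempty.2 hf)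
    exact ⟨m, hm, fun m' hm' => psiLE_of_psiKey_le (hmin m' hm')⟩
  rw [minSupp, dif_pos h]
  exact h.choose_spec.1

lemma eval_ASmat_congr (n : ℕ) {L : List (ℕ × ℕ)} {x y : ℕ × ℕ → ℂ} (h : ∀ β ∈ L, x β = y β)
    (i j : ℕ) : eval x (ASmat n L i j) = eval y (ASmat n L i j) := by
  induction L generalizing j with
  | nil => simp only [ASmat, idN]; split_ifs <;> simp
  | cons β L ih =>
    have ih' := ih fun γ hγ => h γ (List.mem_cons_of_mem _ hγ)
    have hβ := h β List.mem_cons_self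
    rw [ASmat, matMul_factor]
    split_ifs <;> simp [ih', hβ]

lemma ASmat_of_lt {n r : ℕ} {L : List (ℕ × ℕ)} (hL : ∀ β ∈ L, β.2 ≤ r) {i j : ℕ} (hj : r < j)
    (hjn : j ≤ n) : ASmat n L i j = idN i j := by
  induction L with
  | nil => rfl
  | cons β L ih =>
    have hβ : j ≠ β.2 := by have := hL β List.mem_cons_self; omega
    rw [ASmat, matMul_factor, ih fun γ hγ => hL γ (List.mem_cons_of_mem _ hγ)]
    simp [hβ]
    omega

/-- Every maximal minor of rows `1,2,3` of `A_L` with columns in `{1,…,r}` is nonzero. -/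
def MinorsNonzero (n r : ℕ) (L : List (ℕ × ℕ)) : Prop :=
  ∀ K : Fin 3 → ℕ, Function.Injective K → (∀ a, 1 ≤ K a ∧ K a ≤ r) →
    ∃ x : ℕ × ℕ → ℂ,
      Matrix.det (Matrix.of fun a b : Fin 3 => eval x (ASmat n L (a.val + 1) (K b))) ≠ 0

lemma minorsNonzero_nil (n : ℕ) : MinorsNonzero n 3 [] := by
  intro K hK hr
  refine ⟨0, ?_⟩
  have h01 : K 0 ≠ K 1 := hK.ne (by decide)
  have h02 : K 0 ≠ K 2 := hK.ne (by decide)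
  have h12 : K 1 ≠ K 2 := hK.ne (by decide)
  obtain ⟨l0, u0⟩ := hr 0
  obtain ⟨l1, u1⟩ := hr 1
  obtain ⟨l2, u2⟩ := hr 2
  rw [Matrix.det_fin_three]
  simp only [Matrix.of_apply, ASmat, idN]
  generalize K 0 = k0 at *
  generalize K 1 = k1 at *
  generalize K 2 = k2 at *
  interval_cases k0 <;> interval_cases k1 <;> first
    | exact absurd rfl h01
    | (interval_cases k2 <;> first
        | exact absurd rfl h02
        | exact absurd rfl h12
        | simp)

lemma ASmat_triple {n r : ℕ} {L : List (ℕ × ℕ)} (hr : 3 ≤ r) (hrn : r + 1 ≤ n)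
    (hL : ∀ β ∈ L, β.2 ≤ r) {i₁ i₂ i₃ : ℕ} (h₁ : 1 ≤ i₁ ∧ i₁ ≤ r) (h₂ : 1 ≤ i₂ ∧ i₂ ≤ r)
    (h₃ : 1 ≤ i₃ ∧ i₃ ≤ r) {i j : ℕ} (hi : i ≤ 3) (hj : 1 ≤ j ∧ j ≤ r + 1) :
    ASmat n ((i₁, r + 1) :: (i₂, r + 1) :: (i₃, r + 1) :: L) i j =
      if j = r + 1 then ASmat n L i i₁ * X (i₁, r + 1) + ASmat n L i i₂ * X (i₂, r + 1) +
        ASmat n L i i₃ * X (i₃, r + 1)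
      else ASmat n L i j := by
  have m₁ : i₁ ∈ Finset.Icc 1 n := Finset.mem_Icc.2 (by omega)
  have m₂ : i₂ ∈ Finset.Icc 1 n := Finset.mem_Icc.2 (by omega)
  have m₃ : i₃ ∈ Finset.Icc 1 n := Finset.mem_Icc.2 (by omega)
  have mj : j ∈ Finset.Icc 1 n := Finset.mem_Icc.2 (by omega)
  have e₁ : i₁ ≠ r + 1 := by omega
  have e₂ : i₂ ≠ r + 1 := by omega
  simp only [ASmat, matMul_factor, m₁, m₂, m₃, mj, e₁, e₂, if_true, true_and, and_false, if_false,
    add_zero]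
  split_ifs with h
  · have hij : i ≠ r + 1 := by omega
    rw [h, ASmat_of_lt hL (Nat.lt_succ_self r) hrn, idN, if_neg hij]
    ring
  · simp

lemma MinorsNonzero.triple {n r : ℕ} {L : List (ℕ × ℕ)} (hr : 3 ≤ r) (hrn : r + 1 ≤ n)
    (hL : ∀ β ∈ L, β.2 ≤ r) {i₁ i₂ i₃ : ℕ} (h₁ : 1 ≤ i₁ ∧ i₁ ≤ r) (h₂ : 1 ≤ i₂ ∧ i₂ ≤ r)
    (h₃ : 1 ≤ i₃ ∧ i₃ ≤ r) (h₁₂ : i₁ ≠ i₂) (h₁₃ : i₁ ≠ i₃) (h₂₃ : i₂ ≠ i₃)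
    (h : MinorsNonzero n r L) :
    MinorsNonzero n (r + 1) ((i₁, r + 1) :: (i₂, r + 1) :: (i₃, r + 1) :: L) := by
  intro K hK hKr
  by_cases hK' : ∃ b₀, K b₀ = r + 1
  · obtain ⟨b₀, hb₀⟩ := hK'
    obtain ⟨t, ht, htK⟩ : ∃ t ∈ ({i₁, i₂, i₃} : Finset ℕ), t ∉ (Finset.univ.erase b₀).image K := by
      refine Finset.exists_mem_notMem_of_card_lt_card ?_
      rw [Finset.card_eq_three.2 ⟨i₁, i₂, i₃, h₁₂, h₁₃, h₂₃, rfl⟩]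
      exact Finset.card_image_le.trans_lt (by simp)
    have htK' (b : Fin 3) (hb : b ≠ b₀) : K b ≠ t := fun e => htK
      (Finset.mem_image.2 ⟨b, Finset.mem_erase.2 ⟨hb, Finset.mem_univ _⟩, e⟩)
    have hKr' (b : Fin 3) (hb : b ≠ b₀) : K b ≠ r + 1 := fun e => hb (hK (e.trans hb₀.symm))
    simp only [Finset.mem_insert, Finset.mem_singleton] at ht
    have htr : 1 ≤ t ∧ t ≤ r := by rcases ht with rfl | rfl | rfl <;> assumption
    obtain ⟨x, hx⟩ := h (Function.update K b₀ t)
      (by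
        intro a b hab
        by_cases ha : a = b₀ <;> by_cases hb : b = b₀
        · rw [ha, hb]
        · subst ha
          simp only [Function.update_self, Function.update_of_ne hb] at hab
          exact absurd hab.symm (htK' b hb)
        · subst hb
          simp only [Function.update_self, Function.update_of_ne ha] at hab
          exact absurd hab (htK' a ha)
        · simp only [Function.update_of_ne ha, Function.update_of_ne hb] at hab
          exact hK hab)
      (by
        intro a
        by_cases ha : a = b₀
        · subst ha
          simpa using htr
        · have := hKr a
          have := hKr' a ha
          simp only [Function.update_of_ne ha]
          omega)
    let y : ℕ × ℕ → ℂ := fun β => if β.2 = r + 1 then (if β.1 = t then 1 else 0) else x β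
    have hy : ∀ β ∈ L, y β = x β := fun β hβ => if_neg (by have := hL β hβ; omega)
    refine ⟨y, ?_⟩
    convert hx using 5 with a b
    rw [ASmat_triple hr hrn hL h₁ h₂ h₃ (by omega) (hKr b)]
    by_cases hb : b = b₀
    · subst hb
      have hyt (i : ℕ) : y (i, r + 1) = if i = t then 1 else 0 := by simp [y]
      simp only [hb₀, if_true, Function.update_self, map_add, map_mul, eval_X, hyt,
        eval_ASmat_congr n hy]
      rcases ht with rfl | rfl | rfl
      · simp [h₁₂.symm, h₁₃.symm]
      · simp [h₁₂, h₂₃.symm]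
      · simp [h₁₃, h₂₃]
    · rw [if_neg (hKr' b hb), Function.update_of_ne hb, eval_ASmat_congr n hy]
  · push Not at hK'
    obtain ⟨x, hx⟩ := h K hK fun a => by
      have := hKr a
      have := hK' a
      omega
    refine ⟨x, ?_⟩
    convert hx using 5 with a b
    rw [ASmat_triple hr hrn hL h₁ h₂ h₃ (by omega) (hKr b), if_neg (hK' b)]

lemma IsIter.minorsNonzero {n r : ℕ} {S : List (ℕ × ℕ)} (h : IsIter r S) (hrn : r ≤ n) :
    MinorsNonzero n r S := by
  induction h with
  | base L hL =>
    obtain ⟨β₁, β₂, β₃, rfl⟩ := List.length_eq_three.1 hL.length_eq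
    have hmem (β : ℕ × ℕ) (hβ : β ∈ [β₁, β₂, β₃]) : (1 ≤ β.1 ∧ β.1 ≤ 3) ∧ β.2 = 3 + 1 := by
      have := hL.mem_iff.1 hβ
      simp only [List.mem_cons, List.not_mem_nil, or_false] at this
      rcases this with rfl | rfl | rfl <;> simp
    obtain ⟨b₁, e₁⟩ := hmem β₁ (by simp)
    obtain ⟨b₂, e₂⟩ := hmem β₂ (by simp)
    obtain ⟨b₃, e₃⟩ := hmem β₃ (by simp)
    have hnd : [β₁, β₂, β₃].Nodup := hL.nodup_iff.2 (by decide)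
    obtain ⟨i₁, j₁⟩ := β₁
    obtain ⟨i₂, j₂⟩ := β₂
    obtain ⟨i₃, j₃⟩ := β₃
    dsimp only at b₁ b₂ b₃ e₁ e₂ e₃
    subst e₁ e₂ e₃
    simp only [List.nodup_cons, List.mem_cons, List.not_mem_nil, Prod.mk.injEq, and_true,
      or_false, not_or] at hnd
    exact (minorsNonzero_nil n).triple le_rfl hrn (by simp) b₁ b₂ b₃ hnd.1.1 hnd.1.2 hnd.2.1
  | step r L i₁ i₂ i₃ hr hL l₁ u₁ l₂ u₂ l₃ u₃ h₁₂ h₁₃ h₂₃ ih =>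
    exact (ih (by omega)).triple (by omega) hrn hL.exists_append.2
      ⟨l₁, u₁⟩ ⟨l₂, u₂⟩ ⟨l₃, u₃⟩ h₁₂ h₁₃ h₂₃

lemma IsIter.phiStar_ne_zero {n : ℕ} {S : List (ℕ × ℕ)} (h : IsIter n S) {K : Fin 3 → ℕ}
    (hK : Function.Injective K) (hKn : ∀ a, 1 ≤ K a ∧ K a ≤ n) : phiStar n S K ≠ 0 := by
  obtain ⟨x, hx⟩ := h.minorsNonzero le_rfl K hK hKn
  intro h0
  apply hx
  have := congrArg (eval x) h0
  rw [phiStar, RingHom.map_det, map_zero] at this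
  exact this

lemma IsIter.valS_mem_support {n : ℕ} {S : List (ℕ × ℕ)} (h : IsIter n S) {K : Fin 3 → ℕ}
    (hK : Function.Injective K) (hKn : ∀ a, 1 ≤ K a ∧ K a ≤ n) :
    valS n S K ∈ (phiStar n S K).support :=
  minSupp_mem_support S (h.phiStar_ne_zero hK hKn)

lemma weight_eq_of_mem_support {n : ℕ} {S : List (ℕ × ℕ)} {K : Fin 3 → ℕ} {d : (ℕ × ℕ) →₀ ℕ}
    (hd : d ∈ (phiStar n S K).support) (k : ℕ) :
    Finsupp.weight (torusWeight k) d = ∑ a : Fin 3, torusWeight k (a.val + 1, K a) :=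
  isWeightedHomogeneous_phiStar k n S K (mem_support_iff.1 hd)

lemma injective_getD {l : List ℕ} (hl : l.length = 3) (hnd : l.Nodup) :
    Function.Injective fun a : Fin 3 => l.getD a 0 := by
  intro a b hab
  have ha : a.val < l.length := by omega
  have hb : b.val < l.length := by omega
  simp only [List.getD_eq_getElem _ _ ha, List.getD_eq_getElem _ _ hb] at hab
  exact Fin.ext (hnd.getElem_inj_iff.1 hab)

lemma getD_mem_of_length {l : List ℕ} (hl : l.length = 3) (a : Fin 3) : l.getD a 0 ∈ l := by
  have ha : a.val < l.length := by omega
  rw [List.getD_eq_getElem _ _ ha]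
  exact List.getElem_mem ha

lemma sum_getD {l : List ℕ} (hl : l.length = 3) (f : ℕ → ℤ) :
    ∑ a : Fin 3, f (l.getD a 0) = (l.map f).sum := by
  obtain ⟨p, q, r, rfl⟩ := List.length_eq_three.1 hl
  simp [Fin.sum_univ_three, add_assoc]

lemma Sorted.nodup_insert {n : ℕ} {I : Fin 2 → ℕ} (hI : Sorted 2 n I) {j : ℕ}
    (hj : ∀ t, I t ≠ j) : [I 0, I 1, j].Nodup := by
  have h01 : I 0 ≠ I 1 := hI.1.injective.ne (by decide)
  simp [h01, hj 0, hj 1]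

lemma Sorted.nodup_ofFn {n : ℕ} {J : Fin 4 → ℕ} (hJ : Sorted 4 n J) :
    [J 0, J 1, J 2, J 3].Nodup := by
  simpa using List.nodup_ofFn.2 hJ.1.injective

lemma mem_quadruple (J : Fin 4 → ℕ) (a : Fin 4) : J a ∈ [J 0, J 1, J 2, J 3] := by
  fin_cases a <;> simp

lemma length_erase_quadruple (J : Fin 4 → ℕ) (a : Fin 4) :
    ([J 0, J 1, J 2, J 3].erase (J a)).length = 3 := by
  rw [List.length_erase_of_mem (mem_quadruple J a)]
  rfl

lemma insert3_injective {n : ℕ} {I : Fin 2 → ℕ} (hI : Sorted 2 n I) {j : ℕ}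
    (hj : ∀ t, I t ≠ j) : Function.Injective (insert3 I j) :=
  injective_getD (List.length_insertionSort _ _)
    ((List.perm_insertionSort _ _).nodup_iff.2 (hI.nodup_insert hj))

lemma insert3_mem_range {n : ℕ} {I : Fin 2 → ℕ} (hI : Sorted 2 n I) {j : ℕ}
    (hj : 1 ≤ j ∧ j ≤ n) (a : Fin 3) : 1 ≤ insert3 I j a ∧ insert3 I j a ≤ n := by
  have h := (List.perm_insertionSort (· ≤ ·) [I 0, I 1, j]).mem_iff.1
    (getD_mem_of_length (List.length_insertionSort _ _) a)
  change insert3 I j a ∈ _ at h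
  simp only [List.mem_cons, List.not_mem_nil, or_false] at h
  rcases h with h | h | h <;> rw [h]
  exacts [hI.2 0, hI.2 1, hj]

lemma erase4_injective {n : ℕ} {J : Fin 4 → ℕ} (hJ : Sorted 4 n J) (a : Fin 4) :
    Function.Injective (erase4 J (J a)) :=
  injective_getD (length_erase_quadruple J a) (hJ.nodup_ofFn.erase _)

lemma erase4_mem_range {n : ℕ} {J : Fin 4 → ℕ} (hJ : Sorted 4 n J) (a : Fin 4) (b : Fin 3) :
    1 ≤ erase4 J (J a) b ∧ erase4 J (J a) b ≤ n := by
  have h := List.mem_of_mem_erase (getD_mem_of_length (length_erase_quadruple J a) b)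
  change erase4 J (J a) b ∈ _ at h
  simp only [List.mem_cons, List.not_mem_nil, or_false] at h
  rcases h with h | h | h | h <;> rw [h]
  exacts [hJ.2 0, hJ.2 1, hJ.2 2, hJ.2 3]

lemma sum_insert3_add_sum_erase4 (I : Fin 2 → ℕ) (J : Fin 4 → ℕ) (a : Fin 4) (f : ℕ → ℤ) :
    ∑ b, f (insert3 I (J a) b) + ∑ b, f (erase4 J (J a) b) =
      f (I 0) + f (I 1) + (f (J 0) + f (J 1) + f (J 2) + f (J 3)) := by
  have h₁ : ∑ b, f (insert3 I (J a) b) = f (I 0) + f (I 1) + f (J a) := by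
    rw [← add_zero (f (J a)), show (0 : ℤ) = (([] : List ℕ).map f).sum from rfl]
    refine (sum_getD (List.length_insertionSort (· ≤ ·) [I 0, I 1, J a]) f).trans ?_
    rw [((List.perm_insertionSort (· ≤ ·) [I 0, I 1, J a]).map f).sum_eq]
    simp [add_assoc]
  have h₂ : ∑ b, f (erase4 J (J a) b) = (([J 0, J 1, J 2, J 3].erase (J a)).map f).sum :=
    sum_getD (length_erase_quadruple J a) f
  have h₃ := ((List.perm_cons_erase (mem_quadruple J a)).map f).sum_eq
  simp only [List.map_cons, List.sum_cons, List.map_nil, List.sum_nil] at h₃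
  rw [h₁, h₂]
  linarith

lemma IsIter.weight_wvec {n : ℕ} {S : List (ℕ × ℕ)} (h : IsIter n S) {I : Fin 2 → ℕ}
    {J : Fin 4 → ℕ} (hI : Sorted 2 n I) (hJ : Sorted 4 n J) {a : Fin 4}
    (ha : ∀ t, I t ≠ J a) (k : ℕ) :
    Finsupp.weight (torusWeight k) (wvec n S I J a) =
      2 * (∑ b : Fin 3, if b.val + 1 = k then (1 : ℤ) else 0) -
        ((∑ t, if I t = k then 1 else 0) + ∑ t, if J t = k then 1 else 0) := by
  rw [wvec, map_add,
    weight_eq_of_mem_support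
      (h.valS_mem_support (insert3_injective hI ha) (insert3_mem_range hI (hJ.2 a))),
    weight_eq_of_mem_support (h.valS_mem_support (erase4_injective hJ a) (erase4_mem_range hJ a))]
  have := sum_insert3_add_sum_erase4 I J a fun j => if j = k then 1 else 0
  simp only [torusWeight, Finset.sum_sub_distrib, Fin.sum_univ_two, Fin.sum_univ_four] at this ⊢
  linarith

lemma IsIter.mem_of_wvec_ne_zero {n : ℕ} {S : List (ℕ × ℕ)} (h : IsIter n S) {I : Fin 2 → ℕ}
    {J : Fin 4 → ℕ} (hI : Sorted 2 n I) (hJ : Sorted 4 n J) {a : Fin 4}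
    (ha : ∀ t, I t ≠ J a) (β : ℕ × ℕ) (hβ : wvec n S I J a β ≠ 0) : β ∈ S := by
  by_cases h0 : valS n S (insert3 I (J a)) β = 0
  · refine mem_of_mem_support_phiStar
      (h.valS_mem_support (erase4_injective hJ a) (erase4_mem_range hJ a)) fun h1 => hβ ?_
    rw [wvec, Finsupp.add_apply, h0, h1]
  · exact mem_of_mem_support_phiStar
      (h.valS_mem_support (insert3_injective hI ha) (insert3_mem_range hI (hJ.2 a))) h0

/-- If `S` and `S_σ` are iterated sequences with identical iteration triples (the common
prefix `T`), `S` iterated from the PBW sequence `(β₁,β₂,β₃) = b` and `S_σ` from the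
permuted PBW sequence `(β_{σ(1)},β_{σ(2)},β_{σ(3)}) = b ∘ σ`, then any
inequality-preserving functional `e_S` for `S` yields an inequality-preserving
functional `e_{S_σ}` for `S_σ` with `e_{S_σ} M_{S_σ} = e_S M_S`. -/
theorem perm_equality (n : ℕ) (hn : 4 ≤ n) (T : List (ℕ × ℕ)) (hT : T.length = 3 * (n - 4))
    (b : Fin 3 → ℕ × ℕ) (σ : Equiv.Perm (Fin 3))
    (hS : IsIter n (T ++ List.ofFn b)) (hSσ : IsIter n (T ++ List.ofFn (b ∘ σ)))
    (c : ℕ × ℕ → ℤ) (hc : PreservesIneq n (T ++ List.ofFn b) c) :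
    ∃ c' : ℕ × ℕ → ℤ, PreservesIneq n (T ++ List.ofFn (b ∘ σ)) c' ∧
      ∀ K : Fin 3 → ℕ, Sorted 3 n K →
        evalF c' (valS n (T ++ List.ofFn (b ∘ σ)) K) =
        evalF c (valS n (T ++ List.ofFn b) K) := by
  obtain ⟨⟨T₀, L₀, hTL, hT₀, hL₀⟩, -⟩ := hS.exists_append
  obtain ⟨rfl, rfl⟩ := List.append_inj hTL (hT.trans hT₀.symm)
  have hperm : (List.ofFn b).Perm (List.ofFn (b ∘ σ)) := (Equiv.Perm.ofFn_comp_perm σ b).symm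
  have hA : ASmat n (T ++ List.ofFn b) = ASmat n (T ++ List.ofFn (b ∘ σ)) := by
    refine ASmat_append_congr n T (ASmat_perm (Finset.mem_Icc.2 ⟨by simp, hn⟩) hperm fun β hβ => ?_)
    have := hL₀.mem_iff.1 hβ
    simp only [List.mem_cons, List.not_mem_nil, or_false] at this
    rcases this with rfl | rfl | rfl <;> simp
  have hval (K : Fin 3 → ℕ) :
      valS n (T ++ List.ofFn (b ∘ σ)) K = valS n (T ++ List.ofFn b) K := by
    have hphi : phiStar n (T ++ List.ofFn (b ∘ σ)) K = phiStar n (T ++ List.ofFn b) K := by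
      simp only [phiStar, hA]
    rw [valS, valS, hphi]
    refine minSupp_congr fun m hm m' hm' => psiLE_append_iff _ _ ?_
    exact eq_of_weight_eq hL₀ (fun β => mem_of_mem_support_phiStar hm')
      (fun β => mem_of_mem_support_phiStar hm)
      fun k => by rw [weight_eq_of_mem_support hm, weight_eq_of_mem_support hm']
  refine ⟨c, fun I J hI hJ hR s₁ s₂ h₁ h₂ hlt => ?_, fun K _ => by rw [hval]⟩
  have hw (s : Fin 4) :
      wvec n (T ++ List.ofFn (b ∘ σ)) I J s = wvec n (T ++ List.ofFn b) I J s := by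
    rw [wvec, wvec, hval, hval]
  rw [hw, hw] at hlt ⊢
  refine hc I J hI hJ hR s₁ s₂ h₁ h₂ ((psiLT_append_iff _ _ ?_).1 hlt)
  exact eq_of_weight_eq hL₀ (hS.mem_of_wvec_ne_zero hI hJ h₂)
    (hS.mem_of_wvec_ne_zero hI hJ h₁)
    fun k => by rw [hS.weight_wvec hI hJ h₁, hS.weight_wvec hI hJ h₂]
end

section
/- Let S' be an iterated sequence for Gr(3,n−1), let i_1, i_2 ∈ [n−1] and i, j ∈ [n−1]∖{i_1,i_2}, and consider the iterated sequences for Gr(3,n) given by S_1 = ((i_1,n),(i_2,n),(i,n), S') and S_2 = ((i_1,n),(i_2,n),(j,n), S'). If a ℤ-linear map e_{S_1} : ℤ^{3(n−3)} → ℤ preserves inequalities with respect to S_1, then there exists a ℤ-linear map e_{S_2} : ℤ^{3(n−3)} → ℤ that preserves inequalities with respect to S_2 and satisfies e_{S_2}(v_{S_2}(p̄_K)) = e_{S_1}(v_{S_1}(p̄_K)) for every K ∈ I_{3,n} (i.e. e_{S_1}M_{S_1} = e_{S_2}M_{S_2}). -/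
/-!
Common framework: iterated sequences for Gr(3,n), the matrix `A_S`, pullbacks of
Plücker coordinates, the weighted reverse lexicographic order, lowest-term
valuations, Plücker relations, weighting matrices and initial ideals.
-/

open MvPolynomial

section LexOrder

lemma lexLT_cons (β : ℕ × ℕ) (L : List (ℕ × ℕ)) (a b : (ℕ × ℕ) →₀ ℕ) :
    lexLT (β :: L) a b ↔ a β < b β ∨ (a β = b β ∧ lexLT L a b) := by
  constructor
  · rintro ⟨k, hk, h, h'⟩
    cases k with
    | zero => exact Or.inl (by simpa using h')
    | succ k =>
      refine Or.inr ⟨by simpa using h 0 (Nat.succ_pos k), k, by simpa using hk, ?_, ?_⟩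
      · intro p hp
        simpa using h (p + 1) (by omega)
      · simpa using h'
  · rintro (h | ⟨h, k, hk, h₁, h₂⟩)
    · exact ⟨0, by simp, by simp, by simpa using h⟩
    · refine ⟨k + 1, by simpa using hk, ?_, by simpa using h₂⟩
      intro p hp
      cases p with
      | zero => simpa using h
      | succ p => simpa using h₁ p (by omega)

lemma lexLE_nil (a b : (ℕ × ℕ) →₀ ℕ) : lexLE [] a b := Or.inr (by simp)

lemma lexLE_cons (β : ℕ × ℕ) (L : List (ℕ × ℕ)) (a b : (ℕ × ℕ) →₀ ℕ) :
    lexLE (β :: L) a b ↔ a β < b β ∨ (a β = b β ∧ lexLE L a b) := by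
  have key : (∀ k < (β :: L).length, a ((β :: L).getD k (0, 0)) = b ((β :: L).getD k (0, 0))) ↔
      a β = b β ∧ ∀ k < L.length, a (L.getD k (0, 0)) = b (L.getD k (0, 0)) := by
    constructor
    · intro h
      refine ⟨by simpa using h 0 (by simp), fun k hk => ?_⟩
      simpa using h (k + 1) (by simpa using hk)
    · rintro ⟨h, h'⟩ k hk
      cases k with
      | zero => simpa using h
      | succ k => simpa using h' k (by simpa using hk)
  unfold lexLE
  rw [lexLT_cons, key]
  tauto

lemma lexLT_add_right (L : List (ℕ × ℕ)) (a b d : (ℕ × ℕ) →₀ ℕ) :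
    lexLT L (a + d) (b + d) ↔ lexLT L a b := by
  simp [lexLT]

lemma lexLE_add_left (L : List (ℕ × ℕ)) (a b d : (ℕ × ℕ) →₀ ℕ) :
    lexLE L (d + a) (d + b) ↔ lexLE L a b := by
  simp [lexLE, lexLT]

lemma lexLE_antisymm {L : List (ℕ × ℕ)} {a b : (ℕ × ℕ) →₀ ℕ}
    (hab : lexLE L a b) (hba : lexLE L b a) : ∀ β ∈ L, a β = b β := by
  induction L with
  | nil => simp
  | cons β L ih =>
    rw [lexLE_cons] at hab hba
    have h : a β = b β := by omega
    have h₁ : lexLE L a b := by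
      rcases hab with h' | h'
      · omega
      · exact h'.2
    have h₂ : lexLE L b a := by
      rcases hba with h' | h'
      · omega
      · exact h'.2
    intro γ hγ
    rcases List.mem_cons.1 hγ with rfl | hγ
    · exact h
    · exact ih h₁ h₂ γ hγ

lemma exists_lexLE_max (L : List (ℕ × ℕ)) (s : Finset ((ℕ × ℕ) →₀ ℕ)) (hs : s.Nonempty) :
    ∃ d ∈ s, ∀ d' ∈ s, lexLE L d' d := by
  induction L generalizing s with
  | nil =>
    obtain ⟨d, hd⟩ := hs
    exact ⟨d, hd, fun d' _ => lexLE_nil d' d⟩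
  | cons β L ih =>
    obtain ⟨e, he, hmax⟩ := s.exists_max_image (fun d => d β) hs
    obtain ⟨d, hd, hd'⟩ := ih (s.filter fun d => d β = e β) ⟨e, by simp [he]⟩
    rw [Finset.mem_filter] at hd
    refine ⟨d, hd.1, fun d' hd'' => ?_⟩
    rw [lexLE_cons]
    rcases (hmax d' hd'').lt_or_eq with h | h
    · left
      rw [hd.2]
      exact h
    · right
      exact ⟨h.trans hd.2.symm, hd' d' (by simp [hd'', h])⟩

end LexOrder

section Homogeneous

lemma Psi_add (a b : (ℕ × ℕ) →₀ ℕ) : Psi (a + b) = Psi a + Psi b :=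
  Finsupp.sum_add_index' (by simp) (by intros; ring)

lemma Psi_single (β : ℕ × ℕ) : Psi (Finsupp.single β 1) = Ht β := by
  simp [Psi]

/-- Every exponent of `f` lives on the variables in `L` and has height-weight `t - s`. -/
def HeightHom (L : List (ℕ × ℕ)) (s t : ℕ) (f : MvPolynomial (ℕ × ℕ) ℂ) : Prop :=
  ∀ d ∈ f.support, (∀ β, β ∉ L → d β = 0) ∧ Psi d + s = t

variable {L : List (ℕ × ℕ)} {s t s' t' : ℕ} {f g h : MvPolynomial (ℕ × ℕ) ℂ} {β : ℕ × ℕ}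

lemma HeightHom.zero : HeightHom L s t 0 := by
  simp [HeightHom]

lemma HeightHom.one : HeightHom L s s 1 := by
  intro d hd
  have : d = 0 := by
    by_contra hne
    exact (mem_support_iff.1 hd) (by simp [coeff_one, Ne.symm hne])
  subst this
  simp [Psi]

lemma HeightHom.X (hβ : β ∈ L) (h : β.1 ≤ β.2) : HeightHom L β.1 β.2 (X β) := by
  intro d hd
  rw [support_X, Finset.mem_singleton] at hd
  subst hd
  refine ⟨fun γ hγ => ?_, ?_⟩
  · rw [Finsupp.single_apply, if_neg]
    rintro rfl
    exact hγ hβ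
  · rw [Psi_single, Ht]
    omega

lemma HeightHom.add (hf : HeightHom L s t f) (hg : HeightHom L s t g) :
    HeightHom L s t (f + g) := by
  classical
  intro d hd
  rcases Finset.mem_union.1 (support_add hd) with hd | hd
  exacts [hf d hd, hg d hd]

lemma HeightHom.neg (hf : HeightHom L s t f) : HeightHom L s t (-f) := by
  intro d hd
  rw [support_neg] at hd
  exact hf d hd

lemma HeightHom.sub (hf : HeightHom L s t f) (hg : HeightHom L s t g) :
    HeightHom L s t (f - g) := by
  rw [sub_eq_add_neg]
  exact hf.add hg.neg

lemma HeightHom.mul (hf : HeightHom L s t f) (hg : HeightHom L s' t' g) :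
    HeightHom L (s + s') (t + t') (f * g) := by
  classical
  intro d hd
  obtain ⟨a, ha, b, hb, rfl⟩ := Finset.mem_add.1 (support_mul f g hd)
  refine ⟨fun γ hγ => ?_, ?_⟩
  · simp [(hf a ha).1 γ hγ, (hg b hb).1 γ hγ]
  · have h₁ := (hf a ha).2
    have h₂ := (hg b hb).2
    rw [Psi_add]
    omega

lemma HeightHom.mono {L' : List (ℕ × ℕ)} (hL : L ⊆ L') (hf : HeightHom L s t f) :
    HeightHom L' s t f :=
  fun d hd => ⟨fun γ hγ => (hf d hd).1 γ fun hγ' => hγ (hL hγ'), (hf d hd).2⟩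

lemma HeightHom.cast (hf : HeightHom L s t f) {s₁ t₁ : ℕ} (hs : s + t₁ = s₁ + t) :
    HeightHom L s₁ t₁ f := by
  intro d hd
  refine ⟨(hf d hd).1, ?_⟩
  have := (hf d hd).2
  omega

lemma minSupp_eq (hf : HeightHom L s t f) {d : (ℕ × ℕ) →₀ ℕ} (hd : d ∈ f.support)
    (hmax : ∀ d' ∈ f.support, lexLE L d' d) : minSupp L f = d := by
  have hPsi : ∀ d' ∈ f.support, Psi d' = Psi d := fun d' hd' => by
    have h₁ := (hf d' hd').2
    have h₂ := (hf d hd).2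
    omega
  have hex : ∃ m ∈ f.support, ∀ m' ∈ f.support, psiLE L m m' :=
    ⟨d, hd, fun d' hd' => Or.inr ⟨(hPsi d' hd').symm, hmax d' hd'⟩⟩
  rw [minSupp, dif_pos hex]
  obtain ⟨h₁, h₂⟩ := hex.choose_spec
  have h₃ : lexLE L d hex.choose := by
    rcases h₂ d hd with h | h
    · have := hPsi _ h₁
      omega
    · exact h.2
  ext γ
  by_cases hγ : γ ∈ L
  · exact lexLE_antisymm (hmax _ h₁) h₃ γ hγ
  · rw [(hf _ h₁).1 γ hγ, (hf d hd).1 γ hγ]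

lemma minSupp_spec (hf : HeightHom L s t f) (h0 : f ≠ 0) :
    minSupp L f ∈ f.support ∧ ∀ d' ∈ f.support, lexLE L d' (minSupp L f) := by
  obtain ⟨d, hd, hmax⟩ := exists_lexLE_max L f.support (support_nonempty.2 h0)
  rw [minSupp_eq hf hd hmax]
  exact ⟨hd, hmax⟩

lemma minSupp_neg : minSupp L (-f) = minSupp L f := by
  have h : (-f).support = f.support := support_neg _
  unfold minSupp
  generalize (-f).support = A at h ⊢
  subst h
  rfl

lemma minSupp_cons_of_notMem (hf : HeightHom L s t f) (h0 : f ≠ 0) (hβ : β ∉ L) :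
    minSupp (β :: L) f = minSupp L f := by
  obtain ⟨h₁, h₂⟩ := minSupp_spec hf h0
  refine minSupp_eq (hf.mono (List.subset_cons_self _ _)) h₁ fun d' hd' => ?_
  rw [lexLE_cons, (hf d' hd').1 β hβ, (hf _ h₁).1 β hβ]
  exact Or.inr ⟨rfl, h₂ d' hd'⟩

lemma single_add_mem_support (hh : ∀ d ∈ h.support, d β = 0) {d : (ℕ × ℕ) →₀ ℕ}
    (hd : d ∈ g.support) : Finsupp.single β 1 + d ∈ (X β * g + h).support := by
  rw [mem_support_iff, coeff_add, coeff_X_mul]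
  have : coeff (Finsupp.single β 1 + d) h = 0 := by
    by_contra hne
    have := hh _ (mem_support_iff.2 hne)
    simp at this
  rw [this, add_zero]
  exact mem_support_iff.1 hd

lemma X_mul_add_ne_zero (hg : g ≠ 0) (hh : ∀ d ∈ h.support, d β = 0) : X β * g + h ≠ 0 := by
  obtain ⟨d, hd⟩ := support_nonempty.2 hg
  exact support_nonempty.1 ⟨_, single_add_mem_support hh hd⟩

lemma minSupp_X_mul_add (hg : HeightHom L s' t' g) (h0 : g ≠ 0) (hβ : β ∉ L)
    (hh : ∀ d ∈ h.support, d β = 0) (hf : HeightHom (β :: L) s t (X β * g + h)) :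
    minSupp (β :: L) (X β * g + h) = Finsupp.single β 1 + minSupp L g := by
  classical
  obtain ⟨h₁, h₂⟩ := minSupp_spec hg h0
  refine minSupp_eq hf (single_add_mem_support hh h₁) fun d' hd' => ?_
  rw [lexLE_cons]
  have hv : (Finsupp.single β 1 + minSupp L g : (ℕ × ℕ) →₀ ℕ) β = 1 := by simp [(hg _ h₁).1 β hβ]
  rw [hv]
  rcases Finset.mem_union.1 (support_add hd') with hd' | hd'
  · rw [support_X_mul, Finset.mem_map] at hd'
    obtain ⟨e, he, rfl⟩ := hd'
    right
    refine ⟨by simp [(hg e he).1 β hβ], ?_⟩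
    exact (lexLE_add_left _ _ _ _).2 (h₂ e he)
  · left
    simp [hh d' hd']

end Homogeneous

section Matrices

/-- All pairs in `L` are positive roots `(i, j)` with `1 ≤ i < j ≤ m`. -/
def RootList (m : ℕ) (L : List (ℕ × ℕ)) : Prop :=
  ∀ β ∈ L, 1 ≤ β.1 ∧ β.1 < β.2 ∧ β.2 ≤ m

variable {m n : ℕ} {L : List (ℕ × ℕ)}

lemma RootList.mono (hL : RootList m L) (h : m ≤ n) : RootList n L :=
  fun β hβ => ⟨(hL β hβ).1, (hL β hβ).2.1, (hL β hβ).2.2.trans h⟩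

lemma RootList.notMem (hL : RootList m L) (k : ℕ) : (k, m + 1) ∉ L := fun hk => by
  have := (hL _ hk).2.2
  simp at this

lemma RootList.cons₃ (hL : RootList m L) {p q r : ℕ} (hp : 1 ≤ p ∧ p ≤ m) (hq : 1 ≤ q ∧ q ≤ m)
    (hr : 1 ≤ r ∧ r ≤ m) : RootList (m + 1) ((p, m + 1) :: (q, m + 1) :: (r, m + 1) :: L) := by
  intro β hβ
  simp only [List.mem_cons] at hβ
  rcases hβ with rfl | rfl | rfl | hβ
  · exact ⟨hp.1, by simp; omega, by simp⟩
  · exact ⟨hq.1, by simp; omega, by simp⟩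
  · exact ⟨hr.1, by simp; omega, by simp⟩
  · exact hL.mono (Nat.le_succ m) β hβ

lemma ASmat_cons {β : ℕ × ℕ} (hβ : 1 ≤ β.1 ∧ β.1 ≤ n) (a : ℕ) {y : ℕ} (hy : 1 ≤ y ∧ y ≤ n) :
    ASmat n (β :: L) a y = ASmat n L a y + if y = β.2 then ASmat n L a β.1 * X β else 0 := by
  have hβ' : β.1 ∈ Finset.Icc 1 n := Finset.mem_Icc.2 hβ
  have hy' : y ∈ Finset.Icc 1 n := Finset.mem_Icc.2 hy
  simp only [ASmat, matMul, factor, mul_add, Finset.sum_add_distrib, mul_ite, mul_one, mul_zero]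
  congr 1
  · rw [Finset.sum_ite_eq' (Finset.Icc 1 n) y, if_pos hy']
  · by_cases h : y = β.2
    · simp only [h, and_true]
      rw [Finset.sum_ite_eq' (Finset.Icc 1 n) β.1, if_pos hβ', if_pos trivial]
    · simp [h]

lemma ASmat_of_ne (hL : RootList n L) (a : ℕ) {y : ℕ} (hy : 1 ≤ y ∧ y ≤ n)
    (hne : ∀ β ∈ L, y ≠ β.2) : ASmat n L a y = idN a y := by
  induction L with
  | nil => rfl
  | cons β L ih =>
    have hβ := hL β (by simp)
    rw [ASmat_cons ⟨hβ.1, by omega⟩ a hy, if_neg (hne β (by simp)), add_zero,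
      ih (fun γ hγ => hL γ (by simp [hγ])) fun γ hγ => hne γ (by simp [hγ])]

lemma ASmat_heightHom (hL : RootList n L) (a : ℕ) {y : ℕ} (hy : 1 ≤ y ∧ y ≤ n) :
    HeightHom L a y (ASmat n L a y) := by
  induction L generalizing y with
  | nil =>
    simp only [ASmat, idN]
    split_ifs with h
    · subst h
      exact HeightHom.one
    · exact HeightHom.zero
  | cons β L ih =>
    have hβ := hL β (by simp)
    have hL' : RootList n L := fun γ hγ => hL γ (by simp [hγ])
    rw [ASmat_cons ⟨hβ.1, by omega⟩ a hy]
    refine ((ih hL' hy).mono (List.subset_cons_self _ _)).add ?_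
    split_ifs with h
    · subst h
      refine (((ih hL' ⟨hβ.1, by omega⟩).mono (List.subset_cons_self _ _)).mul
        (HeightHom.X (by simp) hβ.2.1.le)).cast ?_
      omega
    · exact HeightHom.zero

lemma phiStar_apply (K : Fin 3 → ℕ) : phiStar n L K =
    ASmat n L 1 (K 0) * ASmat n L 2 (K 1) * ASmat n L 3 (K 2)
    - ASmat n L 1 (K 0) * ASmat n L 2 (K 2) * ASmat n L 3 (K 1)
    - ASmat n L 1 (K 1) * ASmat n L 2 (K 0) * ASmat n L 3 (K 2)
    + ASmat n L 1 (K 1) * ASmat n L 2 (K 2) * ASmat n L 3 (K 0)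
    + ASmat n L 1 (K 2) * ASmat n L 2 (K 0) * ASmat n L 3 (K 1)
    - ASmat n L 1 (K 2) * ASmat n L 2 (K 1) * ASmat n L 3 (K 0) := by
  simp [phiStar, Matrix.det_fin_three]

lemma phiStar_heightHom (hL : RootList n L) {K : Fin 3 → ℕ} (hK : ∀ t, 1 ≤ K t ∧ K t ≤ n) :
    HeightHom L 6 (K 0 + K 1 + K 2) (phiStar n L K) := by
  have h (a : ℕ) (t : Fin 3) := ASmat_heightHom hL a (hK t)
  rw [phiStar_apply]
  refine HeightHom.sub (HeightHom.add (HeightHom.add (HeightHom.sub (HeightHom.sub ?_ ?_) ?_) ?_)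
    ?_) ?_
  all_goals exact (((h _ _).mul (h _ _)).mul (h _ _)).cast (by ring)

lemma phiStar_swap_left (a b k : ℕ) : phiStar n L ![b, a, k] = -phiStar n L ![a, b, k] := by
  simp [phiStar_apply]
  ring

lemma phiStar_swap_right (a b k : ℕ) : phiStar n L ![a, k, b] = -phiStar n L ![a, b, k] := by
  simp [phiStar_apply]
  ring

lemma phiStar_eq_zero_left (a b : ℕ) : phiStar n L ![a, b, a] = 0 := by
  simp [phiStar_apply]

lemma phiStar_eq_zero_right (a b : ℕ) : phiStar n L ![a, b, b] = 0 := by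
  simp [phiStar_apply]

lemma phiStar_cons₃_of_le (hmn : m + 1 ≤ n) {p q r : ℕ} (hp : 1 ≤ p ∧ p ≤ m)
    (hq : 1 ≤ q ∧ q ≤ m) (hr : 1 ≤ r ∧ r ≤ m) {K : Fin 3 → ℕ} (hK : ∀ t, 1 ≤ K t ∧ K t ≤ m) :
    phiStar n ((p, m + 1) :: (q, m + 1) :: (r, m + 1) :: L) K = phiStar n L K := by
  have h (a : ℕ) (t : Fin 3) :
      ASmat n ((p, m + 1) :: (q, m + 1) :: (r, m + 1) :: L) a (K t) = ASmat n L a (K t) := by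
    have hy : 1 ≤ K t ∧ K t ≤ n := ⟨(hK t).1, (hK t).2.trans (by omega)⟩
    have hne : K t ≠ m + 1 := by have := (hK t).2; omega
    rw [ASmat_cons ⟨hp.1, by simp; omega⟩ a hy, ASmat_cons ⟨hq.1, by simp; omega⟩ a hy,
      ASmat_cons ⟨hr.1, by simp; omega⟩ a hy]
    simp [hne]
  simp only [phiStar_apply, h]

lemma phiStar_cons₃_last (hm : 3 ≤ m) (hmn : m + 1 ≤ n) (hL : RootList m L) {p q r : ℕ}
    (hp : 1 ≤ p ∧ p ≤ m) (hq : 1 ≤ q ∧ q ≤ m) (hr : 1 ≤ r ∧ r ≤ m) {a b : ℕ}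
    (ha : 1 ≤ a ∧ a ≤ m) (hb : 1 ≤ b ∧ b ≤ m) :
    phiStar n ((p, m + 1) :: (q, m + 1) :: (r, m + 1) :: L) ![a, b, m + 1] =
      X (p, m + 1) * phiStar n L ![a, b, p] + (X (q, m + 1) * phiStar n L ![a, b, q] +
        X (r, m + 1) * phiStar n L ![a, b, r]) := by
  have h (k : ℕ) {y : ℕ} (hy : 1 ≤ y ∧ y ≤ m) :
      ASmat n ((p, m + 1) :: (q, m + 1) :: (r, m + 1) :: L) k y = ASmat n L k y := by
    have hy' : 1 ≤ y ∧ y ≤ n := ⟨hy.1, by omega⟩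
    have hne : y ≠ m + 1 := by omega
    rw [ASmat_cons ⟨hp.1, by simp; omega⟩ k hy', ASmat_cons ⟨hq.1, by simp; omega⟩ k hy',
      ASmat_cons ⟨hr.1, by simp; omega⟩ k hy']
    simp [hne]
  have h' (k : ℕ) (hk : k ≤ 3) :
      ASmat n ((p, m + 1) :: (q, m + 1) :: (r, m + 1) :: L) k (m + 1) =
        ASmat n L k r * X (r, m + 1) + ASmat n L k q * X (q, m + 1) +
          ASmat n L k p * X (p, m + 1) := by
    have hy : 1 ≤ m + 1 ∧ m + 1 ≤ n := ⟨by omega, hmn⟩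
    have h0 : ASmat n L k (m + 1) = 0 := by
      rw [ASmat_of_ne (hL.mono (by omega)) k hy, idN, if_neg (by omega)]
      intro β hβ
      have := (hL β hβ).2.2
      omega
    have hqm : q ≠ m + 1 := by omega
    have hpm : p ≠ m + 1 := by omega
    rw [ASmat_cons ⟨hp.1, by simp; omega⟩ k hy, ASmat_cons ⟨hq.1, by simp; omega⟩ k hy,
      ASmat_cons ⟨hr.1, by simp; omega⟩ k hy, h0, ASmat_cons ⟨hq.1, by simp; omega⟩ k
        (y := p) ⟨hp.1, by omega⟩, ASmat_cons ⟨hr.1, by simp; omega⟩ k (y := p) ⟨hp.1, by omega⟩,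
      ASmat_cons ⟨hr.1, by simp; omega⟩ k (y := q) ⟨hq.1, by omega⟩]
    simp [hqm, hpm]
  simp only [phiStar_apply, Matrix.cons_val_zero, Matrix.cons_val_one, Matrix.cons_val,
    h _ ha, h _ hb, h' 1 (by omega), h' 2 (by omega), h' 3 le_rfl]
  ring

lemma apply_eq_zero_of_mem_support_X_mul {β γ : ℕ × ℕ} {s t : ℕ} {g : MvPolynomial (ℕ × ℕ) ℂ}
    (hg : HeightHom L s t g) (hβ : β ∉ L) (hne : β ≠ γ) :
    ∀ d ∈ (X γ * g).support, d β = 0 := by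
  intro d hd
  rw [support_X_mul, Finset.mem_map] at hd
  obtain ⟨e, he, rfl⟩ := hd
  simp [(hg e he).1 β hβ, hne]

lemma apply_eq_zero_of_mem_support_add {β : ℕ × ℕ} {f g : MvPolynomial (ℕ × ℕ) ℂ}
    (hf : ∀ d ∈ f.support, d β = 0) (hg : ∀ d ∈ g.support, d β = 0) :
    ∀ d ∈ (f + g).support, d β = 0 := by
  classical
  intro d hd
  rcases Finset.mem_union.1 (support_add hd) with hd | hd
  exacts [hf d hd, hg d hd]

/-- The pullbacks of all Plücker coordinates with distinct columns in `[m]` are nonzero. -/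
def PluckerNonzero (n m : ℕ) (L : List (ℕ × ℕ)) : Prop :=
  ∀ a b k, 1 ≤ a ∧ a ≤ m → 1 ≤ b ∧ b ≤ m → 1 ≤ k ∧ k ≤ m → a ≠ b → a ≠ k → b ≠ k →
    phiStar n L ![a, b, k] ≠ 0

lemma triple_bounds {a b k : ℕ} (ha : 1 ≤ a ∧ a ≤ m) (hb : 1 ≤ b ∧ b ≤ m)
    (hk : 1 ≤ k ∧ k ≤ m) :
    ∀ t, 1 ≤ (![a, b, k] : Fin 3 → ℕ) t ∧ (![a, b, k] : Fin 3 → ℕ) t ≤ m := by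
  intro t
  fin_cases t
  exacts [ha, hb, hk]

lemma PluckerNonzero.nil : PluckerNonzero n 3 [] := by
  intro a b k ha hb hk hab hak hbk
  have ha' : a = 1 ∨ a = 2 ∨ a = 3 := by omega
  have hb' : b = 1 ∨ b = 2 ∨ b = 3 := by omega
  have hk' : k = 1 ∨ k = 2 ∨ k = 3 := by omega
  rcases ha' with rfl | rfl | rfl <;> rcases hb' with rfl | rfl | rfl <;>
    rcases hk' with rfl | rfl | rfl <;> first | omega | simp [phiStar_apply, ASmat, idN]

lemma PluckerNonzero.cons₃ (hm : 3 ≤ m) (hmn : m + 1 ≤ n) (hL : RootList m L)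
    (h : PluckerNonzero n m L) {p q r : ℕ} (hp : 1 ≤ p ∧ p ≤ m) (hq : 1 ≤ q ∧ q ≤ m)
    (hr : 1 ≤ r ∧ r ≤ m) (hpq : p ≠ q) (hpr : p ≠ r) (hqr : q ≠ r) :
    PluckerNonzero n (m + 1) ((p, m + 1) :: (q, m + 1) :: (r, m + 1) :: L) := by
  have last : ∀ a b, 1 ≤ a ∧ a ≤ m → 1 ≤ b ∧ b ≤ m → a ≠ b →
      phiStar n ((p, m + 1) :: (q, m + 1) :: (r, m + 1) :: L) ![a, b, m + 1] ≠ 0 := by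
    intro a b ha hb hab
    rw [phiStar_cons₃_last hm hmn hL hp hq hr ha hb]
    have hz {k l : ℕ} (hl : 1 ≤ l ∧ l ≤ m) (hkl : k ≠ l) :
        ∀ d ∈ (X (l, m + 1) * phiStar n L ![a, b, l]).support, d (k, m + 1) = 0 :=
      apply_eq_zero_of_mem_support_X_mul
        (phiStar_heightHom (hL.mono (by omega))
          (triple_bounds (m := n) (by omega) (by omega) (by omega)))
        (hL.notMem k) (by simp [hkl])
    by_cases hp' : a ≠ p ∧ b ≠ p
    · exact X_mul_add_ne_zero (h a b p ha hb hp hab hp'.1 hp'.2)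
        (apply_eq_zero_of_mem_support_add (hz hq hpq) (hz hr hpr))
    by_cases hq' : a ≠ q ∧ b ≠ q
    · rw [add_left_comm]
      exact X_mul_add_ne_zero (h a b q ha hb hq hab hq'.1 hq'.2)
        (apply_eq_zero_of_mem_support_add (hz hp hpq.symm) (hz hr hqr))
    · rw [add_comm (X (q, m + 1) * _), add_left_comm]
      exact X_mul_add_ne_zero (h a b r ha hb hr hab (by omega) (by omega))
        (apply_eq_zero_of_mem_support_add (hz hp hpr.symm) (hz hq hqr.symm))
  intro a b k ha hb hk hab hak hbk
  by_cases hk' : k = m + 1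
  · subst hk'
    exact last a b (by omega) (by omega) hab
  by_cases hb' : b = m + 1
  · subst hb'
    rw [phiStar_swap_right, neg_ne_zero]
    exact last a k (by omega) (by omega) hak
  by_cases ha' : a = m + 1
  · subst ha'
    rw [phiStar_swap_left, phiStar_swap_right, neg_neg]
    exact last b k (by omega) (by omega) hbk
  · have ha₁ : 1 ≤ a ∧ a ≤ m := by omega
    have hb₁ : 1 ≤ b ∧ b ≤ m := by omega
    have hk₁ : 1 ≤ k ∧ k ≤ m := by omega
    rw [phiStar_cons₃_of_le hmn hp hq hr (triple_bounds ha₁ hb₁ hk₁)]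
    exact h a b k ha₁ hb₁ hk₁ hab hak hbk

lemma IsIter.four_le (h : IsIter m L) : 4 ≤ m := by
  cases h <;> omega

lemma IsIter.rootList (h : IsIter m L) : RootList m L := by
  induction h with
  | base L hL =>
    intro β hβ
    have := hL.mem_iff.1 hβ
    simp only [List.mem_cons, List.not_mem_nil, or_false] at this
    rcases this with rfl | rfl | rfl <;> simp
  | step r L p q k hr _ h₁ h₂ h₃ h₄ h₅ h₆ _ _ _ ih => exact ih.cons₃ ⟨h₁, h₂⟩ ⟨h₃, h₄⟩ ⟨h₅, h₆⟩

lemma IsIter.pluckerNonzero (h : IsIter m L) (hmn : m ≤ n) : PluckerNonzero n m L := by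
  induction h with
  | base L hL =>
    have hlen : L.length = 3 := by simpa using hL.length_eq
    obtain ⟨x, y, z, rfl⟩ := List.length_eq_three.1 hlen
    have hnd := hL.nodup_iff.2 (by decide)
    have hx := hL.mem_iff.1 (show x ∈ [x, y, z] by simp)
    have hy := hL.mem_iff.1 (show y ∈ [x, y, z] by simp)
    have hz := hL.mem_iff.1 (show z ∈ [x, y, z] by simp)
    obtain ⟨x₁, x₂⟩ := x
    obtain ⟨y₁, y₂⟩ := y
    obtain ⟨z₁, z₂⟩ := z
    simp only [List.mem_cons, Prod.mk.injEq, List.not_mem_nil, or_false] at hx hy hz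
    obtain rfl : x₂ = 4 := by omega
    obtain rfl : y₂ = 4 := by omega
    obtain rfl : z₂ = 4 := by omega
    simp only [List.nodup_cons, List.mem_cons, Prod.mk.injEq, and_true, List.not_mem_nil,
      or_false, not_false_eq_true, List.nodup_nil, not_or] at hnd
    exact PluckerNonzero.nil.cons₃ le_rfl hmn (by simp [RootList]) (by omega) (by omega)
      (by omega) (by omega) (by omega) (by omega)
  | step r L p q k hr hL h₁ h₂ h₃ h₄ h₅ h₆ h₇ h₈ h₉ ih =>
    exact (ih (by omega)).cons₃ (by omega) hmn hL.rootList ⟨h₁, h₂⟩ ⟨h₃, h₄⟩ ⟨h₅, h₆⟩ h₇ h₈ h₉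

end Matrices

section Valuation

variable {m p q : ℕ} {L : List (ℕ × ℕ)}

lemma Psi_valS (hL : IsIter m L) {K : Fin 3 → ℕ} (hK : Sorted 3 m K) :
    Psi (valS m L K) + 6 = K 0 + K 1 + K 2 := by
  have hne : phiStar m L K ≠ 0 := by
    have e : K = ![K 0, K 1, K 2] := by
      ext t
      fin_cases t <;> rfl
    rw [e]
    exact hL.pluckerNonzero le_rfl _ _ _ (hK.2 0) (hK.2 1) (hK.2 2)
      (hK.1 (by decide)).ne (hK.1 (by decide)).ne (hK.1 (by decide)).ne
  have hhom := phiStar_heightHom hL.rootList hK.2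
  exact (hhom _ (minSupp_spec hhom hne).1).2

/-- The exponent `v_S(p_{p,q,m+1})` for `S = ((p,m+1),(q,m+1),(r,m+1),L)`. -/
noncomputable def lastExponent (m p q : ℕ) (L : List (ℕ × ℕ)) (r : ℕ) : (ℕ × ℕ) →₀ ℕ :=
  Finsupp.single (r, m + 1) 1 + minSupp L (phiStar (m + 1) L ![p, q, r])

/-- The exponents `v r` depend on `r` only through `lastExponent`. -/
def DependsOnThird (m p q : ℕ) (L : List (ℕ × ℕ)) (v : ℕ → (ℕ × ℕ) →₀ ℕ) : Prop :=
  ∃ (u : (ℕ × ℕ) →₀ ℕ) (k : ℕ), (∀ r, r ≠ p → r ≠ q → u (r, m + 1) = 0) ∧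
    ∀ r, 1 ≤ r ∧ r ≤ m → r ≠ p → r ≠ q → v r = u + k • lastExponent m p q L r

lemma DependsOnThird.add {v w : ℕ → (ℕ × ℕ) →₀ ℕ} (hv : DependsOnThird m p q L v)
    (hw : DependsOnThird m p q L w) : DependsOnThird m p q L fun r => v r + w r := by
  obtain ⟨u, k, h₁, h₂⟩ := hv
  obtain ⟨u', k', h₁', h₂'⟩ := hw
  refine ⟨u + u', k + k', fun r hp hq => by simp [h₁ r hp hq, h₁' r hp hq], fun r hr hp hq => ?_⟩
  simp only [h₂ r hr hp hq, h₂' r hr hp hq, add_smul]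
  abel

lemma dependsOnThird_valS (hL : IsIter m L) (hp : 1 ≤ p ∧ p ≤ m) (hq : 1 ≤ q ∧ q ≤ m)
    (hpq : p ≠ q) {K : Fin 3 → ℕ} (hK : Sorted 3 (m + 1) K) :
    DependsOnThird m p q L fun r =>
      valS (m + 1) ((p, m + 1) :: (q, m + 1) :: (r, m + 1) :: L) K := by
  have hm := hL.four_le
  have hroot := hL.rootList
  have hroot' : RootList (m + 1) L := hroot.mono (Nat.le_succ m)
  have hnz := hL.pluckerNonzero (Nat.le_succ m)
  have e : K = ![K 0, K 1, K 2] := by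
    ext t
    fin_cases t <;> rfl
  have h01 : K 0 < K 1 := hK.1 (by decide)
  have h12 : K 1 < K 2 := hK.1 (by decide)
  have hK0 := hK.2 0
  have hK1 := hK.2 1
  have hK2 := hK.2 2
  generalize K 0 = a at *
  generalize K 1 = b at *
  generalize K 2 = k at *
  subst e
  have ha : 1 ≤ a ∧ a ≤ m := by omega
  have hb : 1 ≤ b ∧ b ≤ m := by omega
  have hom {x y z : ℕ} (hx : 1 ≤ x ∧ x ≤ m) (hy : 1 ≤ y ∧ y ≤ m) (hz : 1 ≤ z ∧ z ≤ m) :=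
    phiStar_heightHom hroot' (triple_bounds (m := m + 1) (a := x) (b := y) (k := z)
      (by omega) (by omega) (by omega))
  have hzero {x y z s : ℕ} (hx : 1 ≤ x ∧ x ≤ m) (hy : 1 ≤ y ∧ y ≤ m) (hz : 1 ≤ z ∧ z ≤ m)
      (h1 : x ≠ y) (h2 : x ≠ z) (h3 : y ≠ z) :
      minSupp L (phiStar (m + 1) L ![x, y, z]) (s, m + 1) = 0 :=
    ((hom hx hy hz) _ (minSupp_spec (hom hx hy hz)
      (hnz x y z hx hy hz h1 h2 h3)).1).1 _ (hroot.notMem s)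
  by_cases hk : k = m + 1
  · subst hk
    have expand {r : ℕ} (hr : 1 ≤ r ∧ r ≤ m) :=
      phiStar_cons₃_last (by omega) le_rfl hroot hp hq hr ha hb
    have homf {r : ℕ} (hr : 1 ≤ r ∧ r ≤ m) :=
      phiStar_heightHom (hroot.cons₃ hp hq hr) hK.2
    have hz {k l : ℕ} (hl : 1 ≤ l ∧ l ≤ m) (hkl : k ≠ l) :
        ∀ d ∈ (X (l, m + 1) * phiStar (m + 1) L ![a, b, l]).support, d (k, m + 1) = 0 :=
      apply_eq_zero_of_mem_support_X_mul (hom ha hb hl) (hroot.notMem k) (by simp [hkl])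
    by_cases hp' : a ≠ p ∧ b ≠ p
    · refine ⟨Finsupp.single (p, m + 1) 1 + minSupp L (phiStar (m + 1) L ![a, b, p]), 0,
        fun r h₁ h₂ => ?_, fun r hr h₁ h₂ => ?_⟩
      · simp [hzero ha hb hp h01.ne hp'.1 hp'.2, h₁]
      · have hp0 := hnz a b p ha hb hp h01.ne hp'.1 hp'.2
        have hf := homf hr
        simp only [valS]
        rw [expand hr] at hf ⊢
        rw [minSupp_X_mul_add ((hom ha hb hp).mono (by intro x hx; simp [hx])) hp0
          (by simp [hpq, h₁.symm, hroot.notMem])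
          (apply_eq_zero_of_mem_support_add (hz hq hpq) (hz hr h₁.symm)) hf,
          minSupp_cons_of_notMem ((hom ha hb hp).mono (by intro x hx; simp [hx])) hp0
            (by simp [h₂.symm, hroot.notMem]),
          minSupp_cons_of_notMem (hom ha hb hp) hp0 (hroot.notMem r)]
        simp
    have hp0 : phiStar (m + 1) L ![a, b, p] = 0 := by
      by_cases h : a = p
      · subst h
        exact phiStar_eq_zero_left a b
      · obtain rfl : b = p := by omega
        exact phiStar_eq_zero_right a b
    have homf' {r : ℕ} (hr : 1 ≤ r ∧ r ≤ m) (h₁ : r ≠ p) (h₂ : r ≠ q) :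
        valS (m + 1) ((p, m + 1) :: (q, m + 1) :: (r, m + 1) :: L) ![a, b, m + 1] =
          minSupp ((q, m + 1) :: (r, m + 1) :: L) (X (q, m + 1) * phiStar (m + 1) L ![a, b, q] +
            X (r, m + 1) * phiStar (m + 1) L ![a, b, r]) ∧
        HeightHom ((q, m + 1) :: (r, m + 1) :: L) 6 (a + b + (m + 1))
          (X (q, m + 1) * phiStar (m + 1) L ![a, b, q] +
            X (r, m + 1) * phiStar (m + 1) L ![a, b, r]) := by
      have hhom : HeightHom ((q, m + 1) :: (r, m + 1) :: L) 6 (a + b + (m + 1))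
          (X (q, m + 1) * phiStar (m + 1) L ![a, b, q] +
            X (r, m + 1) * phiStar (m + 1) L ![a, b, r]) := by
        refine HeightHom.add ?_ ?_
        · refine ((HeightHom.X (by simp) (by simp; omega)).mul
            ((hom ha hb hq).mono (by intro x hx; simp [hx]))).cast ?_
          simp
          omega
        · refine ((HeightHom.X (by simp) (by simp; omega)).mul
            ((hom ha hb hr).mono (by intro x hx; simp [hx]))).cast ?_
          simp
          omega
      refine ⟨?_, hhom⟩
      have hne := (hL.step m L p q r hm hp.1 hp.2 hq.1 hq.2 hr.1 hr.2 hpq h₁.symm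
        h₂.symm).pluckerNonzero le_rfl a b (m + 1) (by omega) (by omega) (by omega) (by omega)
        (by omega) (by omega)
      rw [expand hr, hp0, mul_zero, zero_add] at hne
      simp only [valS]
      rw [expand hr, hp0, mul_zero, zero_add, minSupp_cons_of_notMem hhom hne]
      simp [hpq, h₁.symm, hroot.notMem]
    by_cases hq' : a ≠ q ∧ b ≠ q
    · refine ⟨Finsupp.single (q, m + 1) 1 + minSupp L (phiStar (m + 1) L ![a, b, q]), 0,
        fun r h₁ h₂ => ?_, fun r hr h₁ h₂ => ?_⟩
      · simp [hzero ha hb hq h01.ne hq'.1 hq'.2, h₂]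
      · have hq0 := hnz a b q ha hb hq h01.ne hq'.1 hq'.2
        obtain ⟨hval, hf⟩ := homf' hr h₁ h₂
        simp only [hval]
        rw [minSupp_X_mul_add ((hom ha hb hq).mono (by intro x hx; simp [hx])) hq0
          (by simp [h₂.symm, hroot.notMem]) (hz hr h₂.symm) hf,
          minSupp_cons_of_notMem (hom ha hb hq) hq0 (hroot.notMem r)]
        simp
    have hq0 : phiStar (m + 1) L ![a, b, q] = 0 := by
      by_cases h : a = q
      · subst h
        exact phiStar_eq_zero_left a b
      · obtain rfl : b = q := by omega
        exact phiStar_eq_zero_right a b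
    refine ⟨0, 1, by simp, fun r hr h₁ h₂ => ?_⟩
    have hr0 := hnz a b r ha hb hr h01.ne (by omega) (by omega)
    obtain ⟨hval, hf⟩ := homf' hr h₁ h₂
    have hne : X (r, m + 1) * phiStar (m + 1) L ![a, b, r] ≠ 0 := mul_ne_zero (X_ne_zero _) hr0
    have hhom : HeightHom ((r, m + 1) :: L) (r + 6) (m + 1 + (a + b + r))
        (X (r, m + 1) * phiStar (m + 1) L ![a, b, r]) :=
      (HeightHom.X (by simp) (by simp; omega)).mul
            ((hom ha hb hr).mono (by intro x hx; simp [hx]))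
    have hsupp : minSupp L (phiStar (m + 1) L ![a, b, r]) =
        minSupp L (phiStar (m + 1) L ![p, q, r]) := by
      by_cases h : a = p
      · obtain rfl : b = q := by omega
        rw [h]
      · obtain rfl : a = q := by omega
        obtain rfl : b = p := by omega
        rw [phiStar_swap_left, minSupp_neg]
    simp only [hval]
    rw [hq0, mul_zero, zero_add, minSupp_cons_of_notMem hhom hne (by simp [h₂.symm, hroot.notMem])]
    rw [← add_zero (X (r, m + 1) * _)] at hhom ⊢
    rw [minSupp_X_mul_add (hom ha hb hr) hr0 (hroot.notMem r) (by simp) hhom, hsupp]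
    simp [lastExponent]
  · have hk' : 1 ≤ k ∧ k ≤ m := by omega
    refine ⟨minSupp L (phiStar (m + 1) L ![a, b, k]), 0, fun r h₁ h₂ => ?_, fun r hr h₁ h₂ => ?_⟩
    · exact hzero ha hb hk' h01.ne (by omega) h12.ne
    · have h0 := hnz a b k ha hb hk' h01.ne (by omega) h12.ne
      simp only [valS]
      rw [phiStar_cons₃_of_le le_rfl hp hq hr (triple_bounds ha hb hk'),
        minSupp_cons_of_notMem ((hom ha hb hk').mono (by intro x hx; simp [hx])) h0
          (by simp [hpq, h₁.symm, hroot.notMem]),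
        minSupp_cons_of_notMem ((hom ha hb hk').mono (by intro x hx; simp [hx])) h0
            (by simp [h₂.symm, hroot.notMem]),
        minSupp_cons_of_notMem (hom ha hb hk') h0 (hroot.notMem r)]
      simp

lemma minSupp_apply_last (hL : IsIter m L) (hp : 1 ≤ p ∧ p ≤ m) (hq : 1 ≤ q ∧ q ≤ m)
    (hpq : p ≠ q) {r : ℕ} (hr : 1 ≤ r ∧ r ≤ m) (hrp : r ≠ p) (hrq : r ≠ q) (s : ℕ) :
    minSupp L (phiStar (m + 1) L ![p, q, r]) (s, m + 1) = 0 := by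
  have hroot := hL.rootList
  have hom := phiStar_heightHom (hroot.mono (Nat.le_succ m)) (triple_bounds (m := m + 1) (a := p)
    (b := q) (k := r) (by omega) (by omega) (by omega))
  exact (hom _ (minSupp_spec hom (hL.pluckerNonzero (Nat.le_succ m) p q r hp hq hr hpq hrp.symm
    hrq.symm)).1).1 _ (hroot.notMem s)

lemma lastExponent_apply_last (hL : IsIter m L) (hp : 1 ≤ p ∧ p ≤ m) (hq : 1 ≤ q ∧ q ≤ m)
    (hpq : p ≠ q) {r : ℕ} (hr : 1 ≤ r ∧ r ≤ m) (hrp : r ≠ p) (hrq : r ≠ q) (s : ℕ) :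
    lastExponent m p q L r (s, m + 1) = if r = s then 1 else 0 := by
  rw [lastExponent, Finsupp.add_apply, minSupp_apply_last hL hp hq hpq hr hrp hrq s,
    Finsupp.single_apply, add_zero]
  simp

/-- Comparing two exponents that depend on `r` only through `lastExponent` gives the same
result for every admissible third index `r`. -/
lemma DependsOnThird.lexLT_imp (hL : IsIter m L) (hp : 1 ≤ p ∧ p ≤ m) (hq : 1 ≤ q ∧ q ≤ m)
    (hpq : p ≠ q) {v w : ℕ → (ℕ × ℕ) →₀ ℕ} (hv : DependsOnThird m p q L v)
    (hw : DependsOnThird m p q L w) {i j : ℕ} (hi : 1 ≤ i ∧ i ≤ m) (hip : i ≠ p) (hiq : i ≠ q)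
    (hj : 1 ≤ j ∧ j ≤ m) (hjp : j ≠ p) (hjq : j ≠ q)
    (h : lexLT ((p, m + 1) :: (q, m + 1) :: (j, m + 1) :: L) (v j) (w j)) :
    lexLT ((p, m + 1) :: (q, m + 1) :: (i, m + 1) :: L) (v i) (w i) := by
  obtain ⟨u, k, h₁, h₂⟩ := hv
  obtain ⟨u', k', h₁', h₂'⟩ := hw
  have key {r : ℕ} (hr : 1 ≤ r ∧ r ≤ m) (hrp : r ≠ p) (hrq : r ≠ q) :
      lexLT ((p, m + 1) :: (q, m + 1) :: (r, m + 1) :: L) (v r) (w r) ↔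
        u (p, m + 1) < u' (p, m + 1) ∨ (u (p, m + 1) = u' (p, m + 1) ∧
          (u (q, m + 1) < u' (q, m + 1) ∨ (u (q, m + 1) = u' (q, m + 1) ∧
            (k < k' ∨ (k = k' ∧ lexLT L u u'))))) := by
    have hx := lastExponent_apply_last hL hp hq hpq hr hrp hrq
    rw [lexLT_cons, lexLT_cons, lexLT_cons, h₂ r hr hrp hrq, h₂' r hr hrp hrq]
    simp only [Finsupp.add_apply, Finsupp.smul_apply, hx, if_neg hrp, if_neg hrq, if_true,
      h₁ r hrp hrq, h₁' r hrp hrq, smul_eq_mul, mul_zero, mul_one, add_zero, zero_add]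
    by_cases hk : k = k'
    · subst hk
      rw [lexLT_add_right]
    · simp [hk]
  rw [key hi hip hiq]
  exact (key hj hjp hjq).1 h

end Valuation

section Functional

lemma evalF_add (c : ℕ × ℕ → ℤ) (a b : (ℕ × ℕ) →₀ ℕ) :
    evalF c (a + b) = evalF c a + evalF c b :=
  Finsupp.sum_add_index' (by simp) (by intros; push_cast; ring)

lemma evalF_nsmul (c : ℕ × ℕ → ℤ) (k : ℕ) (a : (ℕ × ℕ) →₀ ℕ) :
    evalF c (k • a) = k * evalF c a := by
  induction k with
  | zero => simp [evalF]
  | succ k ih =>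
    rw [succ_nsmul, evalF_add, ih]
    push_cast
    ring

lemma evalF_update (c : ℕ × ℕ → ℤ) (β : ℕ × ℕ) (x : ℤ) {a : (ℕ × ℕ) →₀ ℕ} (ha : a β = 0) :
    evalF (Function.update c β x) a = evalF c a := by
  refine Finsupp.sum_congr fun γ hγ => ?_
  rw [Function.update_of_ne]
  rintro rfl
  exact (Finsupp.mem_support_iff.1 hγ) ha

lemma evalF_single (c : ℕ × ℕ → ℤ) (β : ℕ × ℕ) : evalF c (Finsupp.single β 1) = c β := by
  simp [evalF]

lemma evalF_update_single_add (c : ℕ × ℕ → ℤ) (β : ℕ × ℕ) (x : ℤ) {a : (ℕ × ℕ) →₀ ℕ}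
    (ha : a β = 0) :
    evalF (Function.update c β x) (Finsupp.single β 1 + a) = x + evalF c a := by
  rw [evalF_add, evalF_single, Function.update_self, evalF_update _ _ _ ha]

/-- Changing one coefficient makes the value at an exponent depending on the third index
agree for two choices of that index. -/
lemma DependsOnThird.evalF_update_eq {m p q : ℕ} {L : List (ℕ × ℕ)} (hL : IsIter m L)
    (hp : 1 ≤ p ∧ p ≤ m) (hq : 1 ≤ q ∧ q ≤ m) (hpq : p ≠ q) {i j : ℕ} (hi : 1 ≤ i ∧ i ≤ m)
    (hip : i ≠ p) (hiq : i ≠ q) (hj : 1 ≤ j ∧ j ≤ m) (hjp : j ≠ p) (hjq : j ≠ q)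
    (c : ℕ × ℕ → ℤ) {v : ℕ → (ℕ × ℕ) →₀ ℕ} (hv : DependsOnThird m p q L v) :
    evalF (Function.update c (j, m + 1) (evalF c (lastExponent m p q L i) -
      evalF c (minSupp L (phiStar (m + 1) L ![p, q, j])))) (v j) = evalF c (v i) := by
  obtain ⟨u, k, h₁, h₂⟩ := hv
  have h := evalF_update_single_add c (j, m + 1) (evalF c (lastExponent m p q L i) -
    evalF c (minSupp L (phiStar (m + 1) L ![p, q, j])))
    (minSupp_apply_last hL hp hq hpq hj hjp hjq j)
  rw [← lastExponent, sub_add_cancel] at h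
  rw [h₂ j hj hjp hjq, h₂ i hi hip hiq, evalF_add, evalF_add, evalF_nsmul, evalF_nsmul,
    evalF_update _ _ _ (h₁ j hjp hjq), h]

end Functional

section Sorted

variable {n : ℕ} {I : Fin 2 → ℕ} {J : Fin 4 → ℕ}

lemma sorted_triple {x y z : ℕ} (hx : 1 ≤ x) (hxy : x < y) (hyz : y < z) (hz : z ≤ n)
    {K : Fin 3 → ℕ} (h0 : K 0 = x) (h1 : K 1 = y) (h2 : K 2 = z) : Sorted 3 n K := by
  refine ⟨Fin.strictMono_iff_lt_succ.2 fun t => ?_, fun t => ?_⟩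
  · fin_cases t
    · change K 0 < K 1
      omega
    · change K 1 < K 2
      omega
  · fin_cases t
    · change 1 ≤ K 0 ∧ K 0 ≤ n
      omega
    · change 1 ≤ K 1 ∧ K 1 ≤ n
      omega
    · change 1 ≤ K 2 ∧ K 2 ≤ n
      omega

lemma sorted_insert3 (hI : Sorted 2 n I) {j : ℕ} (hj : 1 ≤ j ∧ j ≤ n) (hne : ∀ t, I t ≠ j) :
    Sorted 3 n (insert3 I j) ∧
      insert3 I j 0 + insert3 I j 1 + insert3 I j 2 = I 0 + I 1 + j := by
  have h01 : I 0 < I 1 := hI.1 (by decide)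
  have h0 := hI.2 0
  have h1 := hI.2 1
  have hn0 := hne 0
  have hn1 := hne 1
  have H (t : Fin 3) : insert3 I j t =
      if j < I 0 then [j, I 0, I 1].getD t 0 else if j < I 1 then [I 0, j, I 1].getD t 0
        else [I 0, I 1, j].getD t 0 := by
    unfold insert3
    split_ifs with h h'
    · simp [List.insertionSort, List.orderedInsert, h01.le, show ¬ I 0 ≤ j by omega,
        show ¬ I 1 ≤ j by omega]
    · simp [List.insertionSort, List.orderedInsert, show I 0 ≤ j by omega,
        show ¬ I 1 ≤ j by omega]
    · simp [List.insertionSort, h01.le, show I 1 ≤ j by omega]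
  have H0 := H 0
  have H1 := H 1
  have H2 := H 2
  split_ifs at H0 H1 H2 with h h'
  all_goals
    simp at H0 H1 H2
    refine ⟨sorted_triple ?_ ?_ ?_ ?_ H0 H1 H2, ?_⟩ <;> omega

lemma sorted_erase4 (hJ : Sorted 4 n J) (a : Fin 4) :
    Sorted 3 n (erase4 J (J a)) ∧
      erase4 J (J a) 0 + erase4 J (J a) 1 + erase4 J (J a) 2 + J a =
        J 0 + J 1 + J 2 + J 3 := by
  have h01 : J 0 < J 1 := hJ.1 (by decide)
  have h12 : J 1 < J 2 := hJ.1 (by decide)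
  have h23 : J 2 < J 3 := hJ.1 (by decide)
  have h0 := hJ.2 0
  have h3 := hJ.2 3
  have H (t : Fin 3) : erase4 J (J a) t =
      (![[J 1, J 2, J 3], [J 0, J 2, J 3], [J 0, J 1, J 3], [J 0, J 1, J 2]] a).getD t 0 := by
    unfold erase4
    fin_cases a <;> simp [h01.ne, h12.ne, h23.ne, (h01.trans h12).ne,
      (h12.trans h23).ne, (h01.trans (h12.trans h23)).ne]
  have H0 := H 0
  have H1 := H 1
  have H2 := H 2
  fin_cases a
  all_goals
    simp at H0 H1 H2 ⊢
    refine ⟨sorted_triple ?_ ?_ ?_ ?_ H0 H1 H2, ?_⟩ <;> omega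

end Sorted

/-- If `S₁ = ((i₁,n),(i₂,n),(i,n), S')` and `S₂ = ((i₁,n),(i₂,n),(j,n), S')` are iterated
sequences for `Gr(3,n)` (here `n = m+1`) differing only in the third index of the last
iteration, then any inequality-preserving functional `e_{S₁}` for `S₁` yields an
inequality-preserving functional `e_{S₂}` for `S₂` with `e_{S₁} M_{S₁} = e_{S₂} M_{S₂}`. -/
theorem change_equality (m : ℕ) (hm : 4 ≤ m) (S' : List (ℕ × ℕ)) (hS' : IsIter m S')
    (i₁ i₂ i j : ℕ)
    (hi₁ : 1 ≤ i₁ ∧ i₁ ≤ m) (hi₂ : 1 ≤ i₂ ∧ i₂ ≤ m)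
    (hi : 1 ≤ i ∧ i ≤ m) (hj : 1 ≤ j ∧ j ≤ m)
    (h₁₂ : i₁ ≠ i₂) (hii₁ : i ≠ i₁) (hii₂ : i ≠ i₂) (hji₁ : j ≠ i₁) (hji₂ : j ≠ i₂)
    (c : ℕ × ℕ → ℤ)
    (hc : PreservesIneq (m+1) ((i₁, m+1) :: (i₂, m+1) :: (i, m+1) :: S') c) :
    ∃ c' : ℕ × ℕ → ℤ,
      PreservesIneq (m+1) ((i₁, m+1) :: (i₂, m+1) :: (j, m+1) :: S') c' ∧
      ∀ K : Fin 3 → ℕ, Sorted 3 (m+1) K →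
        evalF c' (valS (m+1) ((i₁, m+1) :: (i₂, m+1) :: (j, m+1) :: S') K) =
        evalF c (valS (m+1) ((i₁, m+1) :: (i₂, m+1) :: (i, m+1) :: S') K) := by
  have hiter {r : ℕ} (hr : 1 ≤ r ∧ r ≤ m) (h₁ : r ≠ i₁) (h₂ : r ≠ i₂) :=
    hS'.step m S' i₁ i₂ r hm hi₁.1 hi₁.2 hi₂.1 hi₂.2 hr.1 hr.2 h₁₂ h₁.symm h₂.symm
  obtain ⟨c', heval⟩ : ∃ c' : ℕ × ℕ → ℤ, ∀ v : ℕ → (ℕ × ℕ) →₀ ℕ,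
      DependsOnThird m i₁ i₂ S' v → evalF c' (v j) = evalF c (v i) :=
    ⟨_, fun _ hv => hv.evalF_update_eq hS' hi₁ hi₂ h₁₂ hi hii₁ hii₂ hj hji₁ hji₂ c⟩
  refine ⟨c', ?_, fun K hK => ?_⟩
  swap
  · have hval := heval _ (dependsOnThird_valS hS' hi₁ hi₂ h₁₂ hK)
    exact hval
  intro I J hI hJ hR a b ha hb hab
  have hw {x : Fin 4} (hx : ∀ t : Fin 2, I t ≠ J x) : DependsOnThird m i₁ i₂ S' fun r =>
      wvec (m+1) ((i₁, m+1) :: (i₂, m+1) :: (r, m+1) :: S') I J x := by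
    unfold wvec
    exact (dependsOnThird_valS hS' hi₁ hi₂ h₁₂ (sorted_insert3 hI (hJ.2 x) hx).1).add
      (dependsOnThird_valS hS' hi₁ hi₂ h₁₂ (sorted_erase4 hJ x).1)
  have hPsi {r : ℕ} (hr : 1 ≤ r ∧ r ≤ m) (h₁ : r ≠ i₁) (h₂ : r ≠ i₂) {x : Fin 4}
      (hx : ∀ t : Fin 2, I t ≠ J x) :
      Psi (wvec (m+1) ((i₁, m+1) :: (i₂, m+1) :: (r, m+1) :: S') I J x) + 12 =
        I 0 + I 1 + (J 0 + J 1 + J 2 + J 3) := by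
    obtain ⟨s₁, e₁⟩ := sorted_insert3 hI (hJ.2 x) hx
    obtain ⟨s₂, e₂⟩ := sorted_erase4 hJ x
    have f₁ := Psi_valS (hiter hr h₁ h₂) s₁
    have f₂ := Psi_valS (hiter hr h₁ h₂) s₂
    rw [wvec, Psi_add]
    omega
  have ea := heval _ (hw ha)
  have eb := heval _ (hw hb)
  refine ea.trans_lt (lt_of_lt_of_eq (hc I J hI hJ hR a b ha hb ?_) eb.symm)
  refine Or.inr ⟨Nat.add_right_cancel
    ((hPsi hi hii₁ hii₂ ha).trans (hPsi hi hii₁ hii₂ hb).symm), ?_⟩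
  have hj' := Nat.add_right_cancel ((hPsi hj hji₁ hji₂ ha).trans (hPsi hj hji₁ hji₂ hb).symm)
  exact (hw hb).lexLT_imp hS' hi₁ hi₂ h₁₂ (hw ha) hi hii₁ hii₂ hj hji₁ hji₂
    (hab.resolve_left hj'.not_lt).2
end

section
/- Let n ≥ 5 and suppose that for every iterated sequence S for Gr(3,n) the nonzero Plücker relations form a Gröbner basis of the Plücker ideal with respect to M_S, i.e. In_{M_S}(𝓘_{3,n}) = ⟨ In_{M_S}(R_{I,J}) : I ∈ I_{2,n}, J ∈ I_{4,n}, R_{I,J} ≠ 0 ⟩. Then the number of distinct initial ideals satisfies #{ In_{M_S}(𝓘_{3,n}) : S an iterated sequence for Gr(3,n) } ≤ ∏_{l=0}^{n−5} (n−l−1)(n−l−2). -/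
/-!
Common framework: iterated sequences for Gr(3,n), the matrix `A_S`, pullbacks of
Plücker coordinates, the weighted reverse lexicographic order, lowest-term
valuations, Plücker relations, weighting matrices and initial ideals.
-/

open MvPolynomial

namespace IteratedSeq

/-! ### The lexicographic order -/

lemma lexLT_cons (β : ℕ × ℕ) (S : List (ℕ × ℕ)) (a b : (ℕ × ℕ) →₀ ℕ) :
    lexLT (β :: S) a b ↔ a β < b β ∨ (a β = b β ∧ lexLT S a b) := by
  constructor
  · rintro ⟨k, hk, hm, hlt⟩
    cases k with
    | zero => exact Or.inl (by simpa using hlt)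
    | succ k =>
      refine Or.inr ⟨by simpa using hm 0 (by omega), k, by simpa using hk, fun m hmk => ?_, ?_⟩
      · simpa using hm (m + 1) (by omega)
      · simpa using hlt
  · rintro (h | ⟨h, k, hk, hm, hlt⟩)
    · exact ⟨0, by simp, by simp, by simpa using h⟩
    · refine ⟨k + 1, by simpa using hk, fun m hmk => ?_, by simpa using hlt⟩
      cases m with
      | zero => simpa using h
      | succ m => simpa using hm m (by omega)

lemma lexLE_cons (β : ℕ × ℕ) (S : List (ℕ × ℕ)) (a b : (ℕ × ℕ) →₀ ℕ) :
    lexLE (β :: S) a b ↔ a β < b β ∨ (a β = b β ∧ lexLE S a b) := by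
  have key : (∀ k < (β :: S).length, a ((β :: S).getD k (0, 0)) = b ((β :: S).getD k (0, 0))) ↔
      a β = b β ∧ ∀ k < S.length, a (S.getD k (0, 0)) = b (S.getD k (0, 0)) := by
    constructor
    · intro h
      exact ⟨by simpa using h 0 (by simp), fun k hk => by
        simpa using h (k + 1) (by simpa using hk)⟩
    · rintro ⟨h0, h⟩ k hk
      cases k with
      | zero => simpa using h0
      | succ k => simpa using h k (by simpa using hk)
  unfold lexLE
  rw [key, lexLT_cons]
  tauto

lemma lexLE_refl (S : List (ℕ × ℕ)) (a : (ℕ × ℕ) →₀ ℕ) : lexLE S a a :=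
  Or.inr fun _ _ => rfl

lemma lexLT_add_left (S : List (ℕ × ℕ)) (c a b : (ℕ × ℕ) →₀ ℕ) :
    lexLT S (c + a) (c + b) ↔ lexLT S a b := by
  simp [lexLT]

lemma lexLE_add_left (S : List (ℕ × ℕ)) (c a b : (ℕ × ℕ) →₀ ℕ) :
    lexLE S (c + a) (c + b) ↔ lexLE S a b := by
  simp [lexLE, lexLT]

lemma not_lexLE_of_lexLT {S : List (ℕ × ℕ)} {a b : (ℕ × ℕ) →₀ ℕ} (h : lexLT S a b) :
    ¬ lexLE S b a := by
  induction S with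
  | nil => obtain ⟨k, hk, -⟩ := h; simp at hk
  | cons β S ih =>
    rw [lexLT_cons] at h
    rw [lexLE_cons]
    rintro (h' | ⟨h', h''⟩)
    · omega
    · exact ih (h.resolve_left (by omega)).2 h''

/-! ### Leading monomials -/

/-- `m` is the strictly lex-greatest monomial of `f`. -/
def Lead (S : List (ℕ × ℕ)) (f : MvPolynomial (ℕ × ℕ) ℂ) (m : (ℕ × ℕ) →₀ ℕ) : Prop :=
  m ∈ f.support ∧ ∀ m' ∈ f.support, m' ≠ m → lexLT S m' m

/-- The variable `x_β` does not occur in `f`. -/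
def Free (β : ℕ × ℕ) (f : MvPolynomial (ℕ × ℕ) ℂ) : Prop :=
  ∀ m ∈ f.support, m β = 0

lemma Lead.minSupp_eq {S : List (ℕ × ℕ)} {f : MvPolynomial (ℕ × ℕ) ℂ} {m : (ℕ × ℕ) →₀ ℕ}
    (h : Lead S f m) {w : ℕ} (hw : ∀ m' ∈ f.support, Psi m' + 6 = w) : minSupp S f = m := by
  have hex : ∃ m ∈ f.support, ∀ m' ∈ f.support, psiLE S m m' := by
    refine ⟨m, h.1, fun m' hm' => Or.inr ⟨?_, ?_⟩⟩
    · have := hw m h.1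
      have := hw m' hm'
      omega
    · by_cases hne : m' = m
      · exact hne ▸ lexLE_refl _ _
      · exact Or.inl (h.2 m' hm' hne)
  rw [minSupp, dif_pos hex]
  by_contra hne
  have hs := hex.choose_spec
  have hlt := h.2 _ hs.1 hne
  have h1 := hw m h.1
  have h2 := hw _ hs.1
  rcases hs.2 m h.1 with h' | ⟨-, h'⟩
  · omega
  · exact not_lexLE_of_lexLT hlt h'

lemma Lead.cons {S : List (ℕ × ℕ)} {f : MvPolynomial (ℕ × ℕ) ℂ} {m : (ℕ × ℕ) →₀ ℕ}
    (h : Lead S f m) {β : ℕ × ℕ} (hβ : Free β f) : Lead (β :: S) f m :=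
  ⟨h.1, fun m' hm' hne => (lexLT_cons ..).2
    (Or.inr ⟨by rw [hβ _ hm', hβ _ h.1], h.2 m' hm' hne⟩)⟩

lemma mem_support_X_mul {β : ℕ × ℕ} {f : MvPolynomial (ℕ × ℕ) ℂ} {m : (ℕ × ℕ) →₀ ℕ} :
    m ∈ (X β * f).support ↔ ∃ m' ∈ f.support, m = Finsupp.single β 1 + m' := by
  rw [support_X_mul]
  simp [eq_comm]

lemma Free.add {β : ℕ × ℕ} {f g : MvPolynomial (ℕ × ℕ) ℂ} (hf : Free β f) (hg : Free β g) :
    Free β (f + g) := fun m hm => by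
  classical
  rcases Finset.mem_union.1 (support_add hm) with h | h
  exacts [hf m h, hg m h]

lemma Free.X_mul {β γ : ℕ × ℕ} (hne : γ ≠ β) {f : MvPolynomial (ℕ × ℕ) ℂ} (hf : Free β f) :
    Free β (X γ * f) := fun m hm => by
  obtain ⟨m', hm', rfl⟩ := mem_support_X_mul.1 hm
  simp [hf m' hm', hne]

lemma Free.zero (β : ℕ × ℕ) : Free β 0 := fun m hm => by simp at hm

lemma Lead.X_mul_add {S : List (ℕ × ℕ)} {f g : MvPolynomial (ℕ × ℕ) ℂ} {m : (ℕ × ℕ) →₀ ℕ}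
    {β : ℕ × ℕ} (h : Lead S f m) (hf : Free β f) (hg : Free β g) :
    Lead (β :: S) (X β * f + g) (Finsupp.single β 1 + m) := by
  classical
  have hm := hf m h.1
  refine ⟨?_, fun m' hm' hne => ?_⟩
  · have hgm : coeff (Finsupp.single β 1 + m) g = 0 := by
      by_contra hc
      have := hg _ (mem_support_iff.2 hc)
      simp at this
    rw [mem_support_iff, coeff_add, coeff_X_mul, hgm, add_zero]
    exact mem_support_iff.1 h.1
  · rw [lexLT_cons]
    rcases Finset.mem_union.1 (support_add hm') with h' | h'
    · obtain ⟨m'', hm'', rfl⟩ := mem_support_X_mul.1 h'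
      refine Or.inr ⟨by simp [hf m'' hm'', hm], (lexLT_add_left ..).2 (h.2 m'' hm'' ?_)⟩
      rintro rfl
      exact hne rfl
    · left
      simp [hg m' h']

lemma Lead.neg {S : List (ℕ × ℕ)} {f : MvPolynomial (ℕ × ℕ) ℂ} {m : (ℕ × ℕ) →₀ ℕ}
    (h : Lead S f m) : Lead S (-f) m := by
  simpa only [Lead, support_neg] using h

/-! ### The matrix `A_S` -/

lemma ASmat_cons {n : ℕ} {β : ℕ × ℕ} (S : List (ℕ × ℕ)) (i : ℕ) {j : ℕ}
    (hβ : 1 ≤ β.1 ∧ β.1 ≤ n) (hj : 1 ≤ j ∧ j ≤ n) :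
    ASmat n (β :: S) i j =
      ASmat n S i j + if j = β.2 then X β * ASmat n S i β.1 else 0 := by
  simp only [ASmat, matMul, factor, mul_add, Finset.sum_add_distrib, mul_ite, mul_one, mul_zero]
  congr 1
  · simp [hj.1, hj.2]
  · split_ifs with h
    · simp [h, hβ.1, hβ.2, mul_comm]
    · simp [h]

/-- The valuation of the Plücker coordinate with columns `a, b, c`. -/
noncomputable abbrev W (n : ℕ) (S : List (ℕ × ℕ)) (a b c : ℕ) : (ℕ × ℕ) →₀ ℕ :=
  valS n S ![a, b, c]

lemma phiStar_swap_left (n : ℕ) (S : List (ℕ × ℕ)) (a b c : ℕ) :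
    phiStar n S ![a, b, c] = -phiStar n S ![b, a, c] := by
  simp only [phiStar, Matrix.det_fin_three, Matrix.of_apply]
  simp
  ring

lemma phiStar_swap_right (n : ℕ) (S : List (ℕ × ℕ)) (a b c : ℕ) :
    phiStar n S ![a, b, c] = -phiStar n S ![a, c, b] := by
  simp only [phiStar, Matrix.det_fin_three, Matrix.of_apply]
  simp
  ring

lemma minSupp_neg (S : List (ℕ × ℕ)) (f : MvPolynomial (ℕ × ℕ) ℂ) :
    minSupp S (-f) = minSupp S f := by
  unfold minSupp
  rw [support_neg]

lemma W_swap_left (n : ℕ) (S : List (ℕ × ℕ)) (a b c : ℕ) : W n S a b c = W n S b a c := by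
  rw [W, W, valS, valS, phiStar_swap_left, minSupp_neg]

lemma W_swap_right (n : ℕ) (S : List (ℕ × ℕ)) (a b c : ℕ) : W n S a b c = W n S a c b := by
  rw [W, W, valS, valS, phiStar_swap_right, minSupp_neg]

/-- `a, b, c` are pairwise distinct elements of `{1, …, r}`. -/
structure Triple (r a b c : ℕ) : Prop where
  mem₁ : 1 ≤ a ∧ a ≤ r
  mem₂ : 1 ≤ b ∧ b ≤ r
  mem₃ : 1 ≤ c ∧ c ≤ r
  ne₁₂ : a ≠ b
  ne₁₃ : a ≠ c
  ne₂₃ : b ≠ c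

/-- The polynomial of a Plücker coordinate has a leading monomial, is homogeneous with respect
to heights, and only involves variables whose second index is at most `r`. -/
structure Coord (n r : ℕ) (S : List (ℕ × ℕ)) (a b c : ℕ) : Prop where
  lead : Lead S (phiStar n S ![a, b, c]) (W n S a b c)
  psi : ∀ m ∈ (phiStar n S ![a, b, c]).support, Psi m + 6 = a + b + c
  free : ∀ β : ℕ × ℕ, r < β.2 → Free β (phiStar n S ![a, b, c])

lemma Coord.of_lead {n r : ℕ} {S : List (ℕ × ℕ)} {a b c : ℕ} {m : (ℕ × ℕ) →₀ ℕ}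
    (h : Lead S (phiStar n S ![a, b, c]) m)
    (hp : ∀ m ∈ (phiStar n S ![a, b, c]).support, Psi m + 6 = a + b + c)
    (hf : ∀ β : ℕ × ℕ, r < β.2 → Free β (phiStar n S ![a, b, c])) :
    Coord n r S a b c ∧ W n S a b c = m := by
  have hW : W n S a b c = m := h.minSupp_eq hp
  exact ⟨⟨hW ▸ h, hp, hf⟩, hW⟩

lemma Coord.swap_left {n r : ℕ} {S : List (ℕ × ℕ)} {a b c : ℕ} (h : Coord n r S a b c) :
    Coord n r S b a c := by
  constructor
  · rw [phiStar_swap_left, W_swap_left]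
    exact h.lead.neg
  · rw [phiStar_swap_left, support_neg]
    intro m hm
    rw [h.psi m hm, add_comm a b]
  · rw [phiStar_swap_left]
    intro β hβ m hm
    exact h.free β hβ m (by simpa only [support_neg] using hm)

lemma Coord.swap_right {n r : ℕ} {S : List (ℕ × ℕ)} {a b c : ℕ} (h : Coord n r S a b c) :
    Coord n r S a c b := by
  constructor
  · rw [phiStar_swap_right, W_swap_right]
    exact h.lead.neg
  · rw [phiStar_swap_right, support_neg]
    intro m hm
    rw [h.psi m hm, add_right_comm]
  · rw [phiStar_swap_right]
    intro β hβ m hm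
    exact h.free β hβ m (by simpa only [support_neg] using hm)

/-- The description of `A_S` for a sequence `S` using columns up to `r`. -/
structure Described (n r : ℕ) (S : List (ℕ × ℕ)) : Prop where
  le : 3 ≤ r
  zero : ∀ i < 3, ∀ c, r < c → c ≤ n → ASmat n S (i + 1) c = 0
  coord : ∀ a b c, Triple r a b c → Coord n r S a b c

lemma Described.nil (n : ℕ) : Described n 3 [] := by
  refine ⟨le_rfl, fun i hi c hc _ => ?_, ?_⟩
  · simp only [ASmat, idN]
    rw [if_neg (by omega)]
  · have key : Coord n 3 [] 1 2 3 := by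
      have h1 : phiStar n [] ![1, 2, 3] = 1 := by
        simp [phiStar, Matrix.det_fin_three, ASmat, idN]
      have hs : ∀ m ∈ (phiStar n [] ![1, 2, 3]).support, m = 0 := by
        rw [h1]
        intro m hm
        rw [mem_support_iff, coeff_one] at hm
        by_contra hne
        exact hm (if_neg (Ne.symm hne))
      refine (Coord.of_lead (m := 0) ⟨?_, fun m hm hne => absurd (hs m hm) hne⟩ ?_ ?_).1
      · rw [h1]
        simp
      · intro m hm
        rw [hs m hm]
        simp [Psi]
      · intro β _ m hm
        rw [hs m hm]
        rfl
    rintro a b c ⟨⟨ha, ha'⟩, ⟨hb, hb'⟩, ⟨hc, hc'⟩, h1, h2, h3⟩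
    interval_cases a <;> interval_cases b <;> try omega
    all_goals interval_cases c <;> first
      | omega
      | exact key
      | exact key.swap_right
      | exact key.swap_left
      | exact key.swap_left.swap_right
      | exact key.swap_right.swap_left
      | exact key.swap_left.swap_right.swap_left

/-- The sequence obtained from `L` by prepending the triple `((i₁,r+1), (i₂,r+1), (i₃,r+1))`. -/
abbrev extend (r i₁ i₂ i₃ : ℕ) (L : List (ℕ × ℕ)) : List (ℕ × ℕ) :=
  (i₁, r + 1) :: (i₂, r + 1) :: (i₃, r + 1) :: L

lemma ASmat_extend_old {n r i₁ i₂ i₃ : ℕ} (hi : Triple r i₁ i₂ i₃) (hr : r + 1 ≤ n)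
    (L : List (ℕ × ℕ)) (i : ℕ) {c : ℕ} (hc : 1 ≤ c ∧ c ≤ n) (hne : c ≠ r + 1) :
    ASmat n (extend r i₁ i₂ i₃ L) i c = ASmat n L i c := by
  obtain ⟨h1, h2, h3, -⟩ := hi
  rw [ASmat_cons _ _ ⟨h1.1, by dsimp only; omega⟩ hc, ASmat_cons _ _ ⟨h2.1, by dsimp only; omega⟩ hc,
    ASmat_cons _ _ ⟨h3.1, by dsimp only; omega⟩ hc]
  simp [hne]

lemma ASmat_extend_new {n r i₁ i₂ i₃ : ℕ} (hi : Triple r i₁ i₂ i₃) (hr : r + 1 ≤ n)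
    {L : List (ℕ × ℕ)} (hL : Described n r L) {i : ℕ} (h : i < 3) :
    ASmat n (extend r i₁ i₂ i₃ L) (i + 1) (r + 1) =
      X (i₁, r + 1) * ASmat n L (i + 1) i₁ + (X (i₂, r + 1) * ASmat n L (i + 1) i₂ +
        X (i₃, r + 1) * ASmat n L (i + 1) i₃) := by
  obtain ⟨h1, h2, h3, -⟩ := hi
  have hn : 1 ≤ r + 1 ∧ r + 1 ≤ n := ⟨by omega, hr⟩
  have h1' : 1 ≤ i₁ ∧ i₁ ≤ n := by omega
  have h2' : 1 ≤ i₂ ∧ i₂ ≤ n := by omega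
  have h3' : 1 ≤ i₃ ∧ i₃ ≤ n := by omega
  rw [ASmat_cons _ _ h1' hn, ASmat_cons _ _ h2' hn, ASmat_cons _ _ h3' hn,
    hL.zero i h _ (by omega) hr, ASmat_cons _ _ h2' h1', ASmat_cons _ _ h3' h1',
    ASmat_cons _ _ h3' h2']
  rw [if_neg (show ¬ i₁ = r + 1 by omega), if_neg (show ¬ i₁ = r + 1 by omega),
    if_neg (show ¬ i₂ = r + 1 by omega)]
  simp only [if_true]
  ring

lemma phiStar_extend_old {n r i₁ i₂ i₃ : ℕ} (hi : Triple r i₁ i₂ i₃) (hr : r + 1 ≤ n)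
    (L : List (ℕ × ℕ)) {a b c : ℕ} (h : Triple r a b c) :
    phiStar n (extend r i₁ i₂ i₃ L) ![a, b, c] = phiStar n L ![a, b, c] := by
  obtain ⟨h1, h2, h3, -⟩ := h
  have ea : ∀ i, ASmat n (extend r i₁ i₂ i₃ L) i a = ASmat n L i a := fun i =>
    ASmat_extend_old hi hr L i (by omega) (by omega)
  have eb : ∀ i, ASmat n (extend r i₁ i₂ i₃ L) i b = ASmat n L i b := fun i =>
    ASmat_extend_old hi hr L i (by omega) (by omega)
  have ec : ∀ i, ASmat n (extend r i₁ i₂ i₃ L) i c = ASmat n L i c := fun i =>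
    ASmat_extend_old hi hr L i (by omega) (by omega)
  simp [phiStar, Matrix.det_fin_three, ea, eb, ec]

lemma phiStar_extend_new {n r i₁ i₂ i₃ : ℕ} (hi : Triple r i₁ i₂ i₃) (hr : r + 1 ≤ n)
    {L : List (ℕ × ℕ)} (hL : Described n r L) {a b : ℕ} (ha : 1 ≤ a ∧ a ≤ r)
    (hb : 1 ≤ b ∧ b ≤ r) :
    phiStar n (extend r i₁ i₂ i₃ L) ![a, b, r + 1] =
      X (i₁, r + 1) * phiStar n L ![a, b, i₁] + (X (i₂, r + 1) * phiStar n L ![a, b, i₂] +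
        X (i₃, r + 1) * phiStar n L ![a, b, i₃]) := by
  have ea : ∀ i, ASmat n (extend r i₁ i₂ i₃ L) i a = ASmat n L i a := fun i =>
    ASmat_extend_old hi hr L i (by omega) (by omega)
  have eb : ∀ i, ASmat n (extend r i₁ i₂ i₃ L) i b = ASmat n L i b := fun i =>
    ASmat_extend_old hi hr L i (by omega) (by omega)
  have e0 := ASmat_extend_new hi hr hL (i := 0) (by omega)
  have e1 := ASmat_extend_new hi hr hL (i := 1) (by omega)
  have e2 := ASmat_extend_new hi hr hL (i := 2) (by omega)
  simp only [Nat.reduceAdd] at e0 e1 e2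
  simp only [phiStar, Matrix.det_fin_three, Matrix.of_apply, Matrix.cons_val, Fin.val_zero,
    Fin.val_one, Fin.val_two, Nat.reduceAdd, ea, eb, e0, e1, e2]
  ring

lemma phiStar_eq_zero_left (n : ℕ) (S : List (ℕ × ℕ)) (a b : ℕ) :
    phiStar n S ![a, b, a] = 0 := by
  simp [phiStar, Matrix.det_fin_three]

lemma phiStar_eq_zero_right (n : ℕ) (S : List (ℕ × ℕ)) (a b : ℕ) :
    phiStar n S ![a, b, b] = 0 := by
  simp [phiStar, Matrix.det_fin_three]

lemma Psi_add (a b : (ℕ × ℕ) →₀ ℕ) : Psi (a + b) = Psi a + Psi b := by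
  unfold Psi
  exact Finsupp.sum_add_index' (by simp) (by intros; ring)

lemma Psi_single (β : ℕ × ℕ) : Psi (Finsupp.single β 1) = Ht β := by
  simp [Psi]

/-- How the valuations `V` of a sequence change to `U` on prepending
`((i₁,r+1), (i₂,r+1), (i₃,r+1))`. -/
structure IsExtension (r i₁ i₂ i₃ : ℕ) (V U : ℕ → ℕ → ℕ → (ℕ × ℕ) →₀ ℕ) : Prop where
  triple : Triple r i₁ i₂ i₃
  old_swap_left : ∀ a b c, V a b c = V b a c
  old_swap_right : ∀ a b c, V a b c = V a c b
  swap_left : ∀ a b c, U a b c = U b a c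
  swap_right : ∀ a b c, U a b c = U a c b
  zero : ∀ a b c i, Triple r a b c → V a b c (i, r + 1) = 0
  old : ∀ a b c, Triple r a b c → U a b c = V a b c
  new_first : ∀ a b, Triple r a b i₁ → U a b (r + 1) = Finsupp.single (i₁, r + 1) 1 + V a b i₁
  new_second : ∀ b, Triple r i₁ b i₂ →
    U i₁ b (r + 1) = Finsupp.single (i₂, r + 1) 1 + V i₁ b i₂
  new_third : U i₁ i₂ (r + 1) = Finsupp.single (i₃, r + 1) 1 + V i₁ i₂ i₃

section Extend

variable {n r i₁ i₂ i₃ : ℕ} {L : List (ℕ × ℕ)}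

lemma Coord.extend_old (hi : Triple r i₁ i₂ i₃) (hr : r + 1 ≤ n) (hL : Described n r L)
    {a b c : ℕ} (h : Triple r a b c) :
    Coord n (r + 1) (extend r i₁ i₂ i₃ L) a b c ∧
      W n (extend r i₁ i₂ i₃ L) a b c = W n L a b c := by
  obtain ⟨hl, hp, hf⟩ := hL.coord a b c h
  refine Coord.of_lead ?_ ?_ ?_ <;> rw [phiStar_extend_old hi hr L h]
  · exact ((hl.cons (hf _ (by simp))).cons (hf _ (by simp))).cons (hf _ (by simp))
  · exact hp
  · exact fun β hβ => hf β (by omega)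

lemma phiStar_free (hL : Described n r L) {a b c : ℕ} (hab : a ≠ b) (ha : 1 ≤ a ∧ a ≤ r)
    (hb : 1 ≤ b ∧ b ≤ r) (hc : 1 ≤ c ∧ c ≤ r) {β : ℕ × ℕ} (hβ : r < β.2) :
    Free β (phiStar n L ![a, b, c]) := by
  by_cases h1 : a = c
  · subst h1
    rw [phiStar_eq_zero_left]
    exact Free.zero _
  by_cases h2 : b = c
  · subst h2
    rw [phiStar_eq_zero_right]
    exact Free.zero _
  exact (hL.coord a b c ⟨ha, hb, hc, hab, h1, h2⟩).free β hβ

lemma psi_X_mul_phiStar (hL : Described n r L) {a b i : ℕ} (hab : a ≠ b)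
    (ha : 1 ≤ a ∧ a ≤ r) (hb : 1 ≤ b ∧ b ≤ r) (hi : 1 ≤ i ∧ i ≤ r)
    {m : (ℕ × ℕ) →₀ ℕ} (hm : m ∈ (X (i, r + 1) * phiStar n L ![a, b, i]).support) :
    Psi m + 6 = a + b + (r + 1) := by
  obtain ⟨m', hm', rfl⟩ := mem_support_X_mul.1 hm
  by_cases h1 : a = i
  · subst h1
    rw [phiStar_eq_zero_left] at hm'
    simp at hm'
  by_cases h2 : b = i
  · subst h2
    rw [phiStar_eq_zero_right] at hm'
    simp at hm'
  have := (hL.coord a b i ⟨ha, hb, hi, hab, h1, h2⟩).psi m' hm'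
  rw [Psi_add, Psi_single, Ht]
  dsimp only
  omega

lemma Coord.extend_new_of_lead (hi : Triple r i₁ i₂ i₃) (hr : r + 1 ≤ n) (hL : Described n r L)
    {a b : ℕ} (hab : a ≠ b) (ha : 1 ≤ a ∧ a ≤ r) (hb : 1 ≤ b ∧ b ≤ r) {m : (ℕ × ℕ) →₀ ℕ}
    (h : Lead (extend r i₁ i₂ i₃ L)
      (X (i₁, r + 1) * phiStar n L ![a, b, i₁] + (X (i₂, r + 1) * phiStar n L ![a, b, i₂] +
        X (i₃, r + 1) * phiStar n L ![a, b, i₃])) m) :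
    Coord n (r + 1) (extend r i₁ i₂ i₃ L) a b (r + 1) ∧
      W n (extend r i₁ i₂ i₃ L) a b (r + 1) = m := by
  classical
  refine Coord.of_lead ?_ ?_ ?_ <;> rw [phiStar_extend_new hi hr hL ha hb]
  · exact h
  · intro m hm
    rcases Finset.mem_union.1 (support_add hm) with h' | h'
    · exact psi_X_mul_phiStar hL hab ha hb hi.mem₁ h'
    rcases Finset.mem_union.1 (support_add h') with h' | h'
    · exact psi_X_mul_phiStar hL hab ha hb hi.mem₂ h'
    · exact psi_X_mul_phiStar hL hab ha hb hi.mem₃ h'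
  · intro β hβ
    have hne : ∀ i, (i, r + 1) ≠ β := by
      rintro i rfl
      simp at hβ
    exact ((phiStar_free hL hab ha hb hi.mem₁ (by omega)).X_mul (hne _)).add
      (((phiStar_free hL hab ha hb hi.mem₂ (by omega)).X_mul (hne _)).add
      ((phiStar_free hL hab ha hb hi.mem₃ (by omega)).X_mul (hne _)))

lemma Coord.extend_first (hi : Triple r i₁ i₂ i₃) (hr : r + 1 ≤ n) (hL : Described n r L)
    {a b : ℕ} (h : Triple r a b i₁) :
    Coord n (r + 1) (extend r i₁ i₂ i₃ L) a b (r + 1) ∧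
      W n (extend r i₁ i₂ i₃ L) a b (r + 1) =
        Finsupp.single (i₁, r + 1) 1 + W n L a b i₁ := by
  refine extend_new_of_lead hi hr hL h.ne₁₂ h.mem₁ h.mem₂ ?_
  have hf := fun i c hc => phiStar_free (c := c) hL h.ne₁₂ h.mem₁ h.mem₂ hc
    (β := (i, r + 1)) (Nat.lt_succ_self r)
  have hl := (hL.coord _ _ _ h).lead
  exact ((hl.cons (hf _ _ hi.mem₁)).cons (hf _ _ hi.mem₁)).X_mul_add (hf _ _ hi.mem₁)
    (((hf _ _ hi.mem₂).X_mul (by simpa using hi.ne₁₂.symm)).add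
      ((hf _ _ hi.mem₃).X_mul (by simpa using hi.ne₁₃.symm)))

lemma Coord.extend_second (hi : Triple r i₁ i₂ i₃) (hr : r + 1 ≤ n) (hL : Described n r L)
    {b : ℕ} (h : Triple r i₁ b i₂) :
    Coord n (r + 1) (extend r i₁ i₂ i₃ L) i₁ b (r + 1) ∧
      W n (extend r i₁ i₂ i₃ L) i₁ b (r + 1) =
        Finsupp.single (i₂, r + 1) 1 + W n L i₁ b i₂ := by
  refine extend_new_of_lead hi hr hL h.ne₁₂ h.mem₁ h.mem₂ ?_
  have hf := fun i c hc => phiStar_free (c := c) hL h.ne₁₂ h.mem₁ h.mem₂ hc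
    (β := (i, r + 1)) (Nat.lt_succ_self r)
  have hl := (hL.coord _ _ _ h).lead
  rw [phiStar_eq_zero_left, mul_zero, zero_add]
  exact ((hl.cons (hf _ _ hi.mem₂)).X_mul_add (hf _ _ hi.mem₂)
    ((hf _ _ hi.mem₃).X_mul (by simpa using hi.ne₂₃.symm))).cons
    (((hf _ _ hi.mem₂).X_mul (by simpa using hi.ne₁₂.symm)).add
      ((hf _ _ hi.mem₃).X_mul (by simpa using hi.ne₁₃.symm)))

lemma Coord.extend_third (hi : Triple r i₁ i₂ i₃) (hr : r + 1 ≤ n) (hL : Described n r L) :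
    Coord n (r + 1) (extend r i₁ i₂ i₃ L) i₁ i₂ (r + 1) ∧
      W n (extend r i₁ i₂ i₃ L) i₁ i₂ (r + 1) =
        Finsupp.single (i₃, r + 1) 1 + W n L i₁ i₂ i₃ := by
  refine extend_new_of_lead hi hr hL hi.ne₁₂ hi.mem₁ hi.mem₂ ?_
  have hf := fun i c hc => phiStar_free (c := c) hL hi.ne₁₂ hi.mem₁ hi.mem₂ hc
    (β := (i, r + 1)) (Nat.lt_succ_self r)
  have hl := (hL.coord _ _ _ hi).lead
  rw [phiStar_eq_zero_left, phiStar_eq_zero_right, mul_zero, mul_zero, zero_add, zero_add]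
  have key := hl.X_mul_add (hf _ _ hi.mem₃) (Free.zero (i₃, r + 1))
  rw [add_zero] at key
  exact (key.cons ((hf _ _ hi.mem₃).X_mul (by simpa using hi.ne₂₃.symm))).cons
    ((hf _ _ hi.mem₃).X_mul (by simpa using hi.ne₁₃.symm))

lemma Described.isExtension (hi : Triple r i₁ i₂ i₃) (hr : r + 1 ≤ n) (hL : Described n r L) :
    IsExtension r i₁ i₂ i₃ (W n L) (W n (extend r i₁ i₂ i₃ L)) where
  triple := hi
  old_swap_left := W_swap_left n L
  old_swap_right := W_swap_right n L
  swap_left := W_swap_left n _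
  swap_right := W_swap_right n _
  zero a b c i h := by
    have hc := hL.coord a b c h
    exact hc.free (i, r + 1) (Nat.lt_succ_self r) _ hc.lead.1
  old _ _ _ h := (Coord.extend_old hi hr hL h).2
  new_first _ _ h := (Coord.extend_first hi hr hL h).2
  new_second _ h := (Coord.extend_second hi hr hL h).2
  new_third := (Coord.extend_third hi hr hL).2

lemma Coord.extend_new (hi : Triple r i₁ i₂ i₃) (hr : r + 1 ≤ n) (hL : Described n r L)
    {a b : ℕ} (hab : a ≠ b) (ha : 1 ≤ a ∧ a ≤ r) (hb : 1 ≤ b ∧ b ≤ r) :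
    Coord n (r + 1) (extend r i₁ i₂ i₃ L) a b (r + 1) := by
  by_cases h1 : a = i₁
  · subst h1
    by_cases h2 : b = i₂
    · subst h2
      exact (extend_third hi hr hL).1
    · exact (extend_second hi hr hL ⟨ha, hb, hi.mem₂, hab, hi.ne₁₂, h2⟩).1
  by_cases h2 : b = i₁
  · subst h2
    refine swap_left ?_
    by_cases h2 : a = i₂
    · subst h2
      exact (extend_third hi hr hL).1
    · exact (extend_second hi hr hL ⟨hb, ha, hi.mem₂, hab.symm, hi.ne₁₂, h2⟩).1
  exact (extend_first hi hr hL ⟨ha, hb, hi.mem₁, hab, h1, h2⟩).1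

lemma Described.extend (hi : Triple r i₁ i₂ i₃) (hr : r + 1 ≤ n) (hL : Described n r L) :
    Described n (r + 1) (extend r i₁ i₂ i₃ L) := by
  have h3 := hL.le
  refine ⟨by omega, fun i h c hc hc' => ?_, ?_⟩
  · rw [ASmat_extend_old hi hr L _ (by omega) (by omega)]
    exact hL.zero i h c (by omega) hc'
  · rintro a b c ⟨ha, hb, hc, hab, hac, hbc⟩
    by_cases h1 : a = r + 1
    · subst h1
      exact (Coord.extend_new hi hr hL hbc (by omega) (by omega)).swap_right.swap_left
    by_cases h2 : b = r + 1
    · subst h2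
      exact (Coord.extend_new hi hr hL hac (by omega) (by omega)).swap_right
    by_cases h3 : c = r + 1
    · subst h3
      exact Coord.extend_new hi hr hL hab (by omega) (by omega)
    · exact (Coord.extend_old hi hr hL
        ⟨by omega, by omega, by omega, hab, hac, hbc⟩).1

end Extend

/-! ### Comparing the weights of two terms of a Plücker relation -/

/-- The comparison of `X t` with `Y t` in the lexicographic order of `S t` does not depend
on `t`. -/
def Agree {ι : Type*} (S : ι → List (ℕ × ℕ)) (X Y : ι → (ℕ × ℕ) →₀ ℕ) : Prop :=
  ∀ s t, (lexLE (S s) (X s) (Y s) → lexLE (S t) (X t) (Y t)) ∧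
    (lexLE (S s) (Y s) (X s) → lexLE (S t) (Y t) (X t))

section Agree

variable {ι : Type*} {S : ι → List (ℕ × ℕ)} {X Y : ι → (ℕ × ℕ) →₀ ℕ}

lemma Agree.symm (h : Agree S X Y) : Agree S Y X := fun s t => (h s t).symm

lemma Agree.of_eq (h : ∀ t, X t = Y t) : Agree S X Y := fun _ t =>
  ⟨fun _ => h t ▸ lexLE_refl _ _, fun _ => h t ▸ lexLE_refl _ _⟩

lemma Agree.of_lt_first {β : ℕ × ℕ} (h : ∀ t, X t β < Y t β) :
    Agree (fun t => β :: S t) X Y := fun s t => by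
  have h1 := h s
  have h2 := h t
  simp only [lexLE_cons]
  omega

lemma Agree.cons {β : ℕ × ℕ} (h : ∀ t, X t β = Y t β) (hA : Agree S X Y) :
    Agree (fun t => β :: S t) X Y := fun s t => by
  simpa [lexLE_cons, h s, h t] using hA s t

lemma Agree.cons' {β : ι → ℕ × ℕ} (h : ∀ t, X t (β t) = Y t (β t)) (hA : Agree S X Y) :
    Agree (fun t => β t :: S t) X Y := fun s t => by
  simpa [lexLE_cons, h s, h t] using hA s t

lemma Agree.add_left (C : ι → (ℕ × ℕ) →₀ ℕ) (h : Agree S X Y) :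
    Agree S (fun t => C t + X t) (fun t => C t + Y t) := fun s t => by
  simpa [lexLE_add_left] using h s t

end Agree

section Compare

variable {ι : Type*} {r i₁ i₂ : ℕ} {i₃ : ι → ℕ} {L : ι → List (ℕ × ℕ)}
  {V U : ι → ℕ → ℕ → ℕ → (ℕ × ℕ) →₀ ℕ}

/-- `a, b, j, k` are pairwise distinct elements of `{1, …, r}`. -/
structure Quad (r a b j k : ℕ) : Prop where
  left : Triple r a b j
  right : Triple r a b k
  ne : j ≠ k

/-- All the comparisons between two terms of a Plücker relation with indices up to `r` are
independent of the parameter. -/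
def Uniform (r : ℕ) (S : ι → List (ℕ × ℕ)) (V : ι → ℕ → ℕ → ℕ → (ℕ × ℕ) →₀ ℕ) : Prop :=
  ∀ a b c d j k, Quad r a b j k → Quad r c d j k →
    Agree S (fun t => V t a b j + V t c d k) (fun t => V t a b k + V t c d j)

section Evaluation

variable {i₃ : ℕ} {V U : ℕ → ℕ → ℕ → (ℕ × ℕ) →₀ ℕ}

lemma IsExtension.new_second' (h : IsExtension r i₁ i₂ i₃ V U) (b : ℕ) (hb : Triple r i₁ b i₂) :
    U b i₁ (r + 1) = Finsupp.single (i₂, r + 1) 1 + V i₁ b i₂ := by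
  rw [h.swap_left, h.new_second b hb]

lemma IsExtension.eval_first_one (h : IsExtension r i₁ i₂ i₃ V U) {a b : ℕ}
    (hab : Triple r a b i₁) : U a b (r + 1) (i₁, r + 1) = 1 := by
  rw [h.new_first a b hab]
  simp [h.zero a b i₁ i₁ hab]

lemma IsExtension.eval_first_zero (h : IsExtension r i₁ i₂ i₃ V U) {b : ℕ}
    (hb : 1 ≤ b ∧ b ≤ r) (hne : i₁ ≠ b) : U i₁ b (r + 1) (i₁, r + 1) = 0 := by
  have hi := h.triple
  by_cases h2 : b = i₂
  · subst h2
    rw [h.new_third]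
    simp [h.zero _ _ _ _ hi, hi.ne₁₃.symm]
  · have hb' : Triple r i₁ b i₂ := ⟨hi.mem₁, hb, hi.mem₂, hne, hi.ne₁₂, h2⟩
    rw [h.new_second b hb']
    simp [h.zero _ _ _ _ hb', hi.ne₁₂.symm]

lemma IsExtension.eval_first_zero' (h : IsExtension r i₁ i₂ i₃ V U) {b : ℕ}
    (hb : 1 ≤ b ∧ b ≤ r) (hne : i₁ ≠ b) : U b i₁ (r + 1) (i₁, r + 1) = 0 := by
  rw [h.swap_left, h.eval_first_zero hb hne]

lemma IsExtension.eval_second_zero (h : IsExtension r i₁ i₂ i₃ V U) {a b : ℕ}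
    (hab : Triple r a b i₁) : U a b (r + 1) (i₂, r + 1) = 0 := by
  rw [h.new_first a b hab]
  simp [h.zero a b i₁ i₂ hab, h.triple.ne₁₂]

lemma IsExtension.eval_second_one (h : IsExtension r i₁ i₂ i₃ V U) {b : ℕ}
    (hb : Triple r i₁ b i₂) : U i₁ b (r + 1) (i₂, r + 1) = 1 := by
  rw [h.new_second b hb]
  simp [h.zero _ _ _ _ hb]

lemma IsExtension.eval_second_one' (h : IsExtension r i₁ i₂ i₃ V U) {b : ℕ}
    (hb : Triple r i₁ b i₂) : U b i₁ (r + 1) (i₂, r + 1) = 1 := by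
  rw [h.swap_left, h.eval_second_one hb]

lemma IsExtension.eval_third (h : IsExtension r i₁ i₂ i₃ V U) :
    U i₁ i₂ (r + 1) (i₂, r + 1) = 0 := by
  rw [h.new_third]
  simp [h.zero _ _ _ _ h.triple, h.triple.ne₂₃.symm]

lemma IsExtension.eval_third' (h : IsExtension r i₁ i₂ i₃ V U) :
    U i₂ i₁ (r + 1) (i₂, r + 1) = 0 := by
  rw [h.swap_left, h.eval_third]

end Evaluation

lemma Agree.of_lt_second {β γ : ℕ × ℕ} {S : ι → List (ℕ × ℕ)} {X Y : ι → (ℕ × ℕ) →₀ ℕ}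
    (h₁ : ∀ t, X t β = Y t β) (h₂ : ∀ t, X t γ < Y t γ) :
    Agree (fun t => β :: γ :: S t) X Y :=
  Agree.cons h₁ (Agree.of_lt_first h₂)

lemma Agree.congr {S : ι → List (ℕ × ℕ)} {X Y X' Y' : ι → (ℕ × ℕ) →₀ ℕ}
    (h : Agree S X' Y') (hX : ∀ t, X t = X' t) (hY : ∀ t, Y t = Y' t) : Agree S X Y := by
  rwa [funext hX, funext hY]

/-- A comparison that reduces to one for the shorter sequence. -/
lemma Uniform.lift (hu : Uniform r L V) (h : ∀ t, IsExtension r i₁ i₂ (i₃ t) (V t) (U t))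
    (a b c d j k : ℕ) (hab : Quad r a b j k) (hcd : Quad r c d j k)
    (C : ι → (ℕ × ℕ) →₀ ℕ) {X Y : ι → (ℕ × ℕ) →₀ ℕ}
    (hX : ∀ t, X t = C t + (V t a b j + V t c d k))
    (hY : ∀ t, Y t = C t + (V t a b k + V t c d j)) :
    Agree (fun t => extend r i₁ i₂ (i₃ t) (L t)) X Y := by
  have hz : ∀ t i, (V t a b j + V t c d k) (i, r + 1) = (V t a b k + V t c d j) (i, r + 1) := by
    intro t i
    rw [Finsupp.add_apply, Finsupp.add_apply, (h t).zero _ _ _ _ hab.left,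
      (h t).zero _ _ _ _ hab.right, (h t).zero _ _ _ _ hcd.left, (h t).zero _ _ _ _ hcd.right]
  exact ((((hu a b c d j k hab hcd).cons' fun t => hz t (i₃ t)).cons fun t => hz t i₂).cons
    fun t => hz t i₁).add_left C |>.congr hX hY

lemma Uniform.agree_new_left (hu : Uniform r L V)
    (h : ∀ t, IsExtension r i₁ i₂ (i₃ t) (V t) (U t)) {b c d j k : ℕ} (hb : Triple r b j k)
    (hcd : Quad r c d j k) :
    Agree (fun t => extend r i₁ i₂ (i₃ t) (L t))
      (fun t => U t b j (r + 1) + V t c d k) (fun t => U t b k (r + 1) + V t c d j) := by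
  rcases isEmpty_or_nonempty ι with hι | ⟨⟨t₀⟩⟩
  · exact fun s => isEmptyElim s
  have hi₁ := (h t₀).triple.mem₁
  have hi₂ := (h t₀).triple.mem₂
  have hi₁₂ := (h t₀).triple.ne₁₂
  have hz₁ : ∀ t i, V t c d k (i, r + 1) = 0 := fun t i => (h t).zero _ _ _ _ hcd.right
  have hz₂ : ∀ t i, V t c d j (i, r + 1) = 0 := fun t i => (h t).zero _ _ _ _ hcd.left
  obtain ⟨hb₁, hj₁, hk₁, hbj, hbk, hjk⟩ := hb
  by_cases h1 : i₁ = b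
  · subst h1
    by_cases h2 : i₂ = j
    · subst h2
      refine Agree.of_lt_second (fun t => ?_) (fun t => ?_)
      · simp [(h t).eval_first_zero, *]
      · simp [hz₁, hz₂, (h t).eval_third, (h t).eval_second_one ⟨hb₁, hk₁, hi₂, hbk, hi₁₂, hjk.symm⟩]
    by_cases h3 : i₂ = k
    · subst h3
      refine (Agree.of_lt_second (fun t => ?_) (fun t => ?_)).symm
      · simp [(h t).eval_first_zero, *]
      · simp [hz₁, hz₂, (h t).eval_third, (h t).eval_second_one ⟨hb₁, hj₁, hi₂, hbj, hi₁₂, hjk⟩]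
    have hq : Quad r i₁ i₂ j k := by constructor <;> (try constructor) <;> omega
    refine hu.lift h i₁ i₂ c d j k hq hcd (fun _ => Finsupp.single (i₂, r + 1) 1)
      (fun t => ?_) (fun t => ?_)
    · rw [(h t).new_second j (by constructor <;> omega), (h t).old_swap_right, add_assoc]
    · rw [(h t).new_second k (by constructor <;> omega), (h t).old_swap_right, add_assoc]
  by_cases h2 : i₁ = j
  · subst h2
    refine Agree.of_lt_first fun t => ?_
    simp [hz₁, hz₂, (h t).eval_first_zero' hb₁ h1,
      (h t).eval_first_one (a := b) (b := k) (by constructor <;> omega)]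
  by_cases h3 : i₁ = k
  · subst h3
    refine (Agree.of_lt_first fun t => ?_).symm
    simp [hz₁, hz₂, (h t).eval_first_zero' hb₁ h1,
      (h t).eval_first_one (a := b) (b := j) (by constructor <;> omega)]
  have hq : Quad r b i₁ j k := by constructor <;> (try constructor) <;> omega
  refine hu.lift h b i₁ c d j k hq hcd (fun _ => Finsupp.single (i₁, r + 1) 1)
    (fun t => ?_) (fun t => ?_)
  · rw [(h t).new_first b j (by constructor <;> omega), (h t).old_swap_right, add_assoc]
  · rw [(h t).new_first b k (by constructor <;> omega), (h t).old_swap_right, add_assoc]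

/-- The case of two new indices, when the first new root shares an index with `b`. -/
lemma Uniform.agree_new_both_of_eq_left (hu : Uniform r L V)
    (h : ∀ t, IsExtension r i₁ i₂ (i₃ t) (V t) (U t)) {d j k : ℕ} (hb : Triple r i₁ j k)
    (hd : Triple r d j k) (hbd : i₁ ≠ d) :
    Agree (fun t => extend r i₁ i₂ (i₃ t) (L t))
      (fun t => U t i₁ j (r + 1) + U t d k (r + 1))
      (fun t => U t i₁ k (r + 1) + U t d j (r + 1)) := by
  rcases isEmpty_or_nonempty ι with hι | ⟨⟨t₀⟩⟩
  · exact fun s => isEmptyElim s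
  have hi₂ := (h t₀).triple.mem₂
  have hi₁₂ := (h t₀).triple.ne₁₂
  obtain ⟨hb₁, hj₁, hk₁, hbj, hbk, hjk⟩ := hb
  obtain ⟨hd₁, -, -, hdj, hdk, -⟩ := hd
  have hdj' : Triple r d j i₁ := by constructor <;> omega
  have hdk' : Triple r d k i₁ := by constructor <;> omega
  by_cases h2 : i₂ = j
  · subst h2
    refine Agree.of_lt_second (fun t => ?_) (fun t => ?_)
    · simp [(h t).eval_first_zero, (h t).eval_first_one, *]
    · simp [(h t).eval_third, (h t).eval_second_zero, hdj', hdk',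
        (h t).eval_second_one (b := k) (by constructor <;> omega)]
  by_cases h3 : i₂ = k
  · subst h3
    refine (Agree.of_lt_second (fun t => ?_) (fun t => ?_)).symm
    · simp [(h t).eval_first_zero, (h t).eval_first_one, *]
    · simp [(h t).eval_third, (h t).eval_second_zero, hdj', hdk',
        (h t).eval_second_one (b := j) (by constructor <;> omega)]
  have ej : ∀ t, U t i₁ j (r + 1) = _ := fun t => (h t).new_second j (by constructor <;> omega)
  have ek : ∀ t, U t i₁ k (r + 1) = _ := fun t => (h t).new_second k (by constructor <;> omega)
  have edj : ∀ t, U t d j (r + 1) = _ := fun t => (h t).new_first d j hdj'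
  have edk : ∀ t, U t d k (r + 1) = _ := fun t => (h t).new_first d k hdk'
  by_cases h4 : i₂ = d
  · subst h4
    refine Agree.of_eq fun t => ?_
    simp only [ej, ek, edj, edk, (h t).old_swap_left, (h t).old_swap_right, add_comm,
      add_left_comm, add_assoc]
  refine hu.lift h i₁ i₂ i₁ d j k (by constructor <;> (try constructor) <;> omega)
    (by constructor <;> (try constructor) <;> omega)
    (fun _ => Finsupp.single (i₁, r + 1) 1 + Finsupp.single (i₂, r + 1) 1)
    (fun t => ?_) (fun t => ?_)
  · simp only [ej, edk, (h t).old_swap_left, (h t).old_swap_right, add_comm,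
      add_left_comm, add_assoc]
  · simp only [ek, edj, (h t).old_swap_left, (h t).old_swap_right, add_comm,
      add_left_comm, add_assoc]

/-- The case of two new indices, when the first new root meets the exchanged index `j`. -/
lemma Uniform.agree_new_both_of_eq_exchanged (hu : Uniform r L V)
    (h : ∀ t, IsExtension r i₁ i₂ (i₃ t) (V t) (U t)) {b d k : ℕ} (hb : Triple r b i₁ k)
    (hd : Triple r d i₁ k) (hbd : b ≠ d) :
    Agree (fun t => extend r i₁ i₂ (i₃ t) (L t))
      (fun t => U t b i₁ (r + 1) + U t d k (r + 1))
      (fun t => U t b k (r + 1) + U t d i₁ (r + 1)) := by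
  rcases isEmpty_or_nonempty ι with hι | ⟨⟨t₀⟩⟩
  · exact fun s => isEmptyElim s
  have hi₂ := (h t₀).triple.mem₂
  have hi₁₂ := (h t₀).triple.ne₁₂
  obtain ⟨hb₁, hj₁, hk₁, hbj, hbk, hjk⟩ := hb
  obtain ⟨hd₁, -, -, hdj, hdk, -⟩ := hd
  have hbk' : Triple r b k i₁ := by constructor <;> omega
  have hdk' : Triple r d k i₁ := by constructor <;> omega
  by_cases h2 : i₂ = b
  · subst h2
    refine Agree.of_lt_second (fun t => ?_) (fun t => ?_)
    · simp [(h t).eval_first_zero' hb₁ hbj.symm, (h t).eval_first_zero' hd₁ hdj.symm,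
        (h t).eval_first_one, *]
    · simp [(h t).eval_third', (h t).eval_second_zero, hbk', hdk',
        (h t).eval_second_one' (b := d) (by constructor <;> omega)]
  by_cases h3 : i₂ = d
  · subst h3
    refine (Agree.of_lt_second (fun t => ?_) (fun t => ?_)).symm
    · simp [(h t).eval_first_zero' hb₁ hbj.symm, (h t).eval_first_zero' hd₁ hdj.symm,
        (h t).eval_first_one, *]
    · simp [(h t).eval_third', (h t).eval_second_zero, hbk', hdk',
        (h t).eval_second_one' (b := b) (by constructor <;> omega)]
  have eb : ∀ t, U t b i₁ (r + 1) = _ := fun t => (h t).new_second' b (by constructor <;> omega)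
  have ed : ∀ t, U t d i₁ (r + 1) = _ := fun t => (h t).new_second' d (by constructor <;> omega)
  have ebk : ∀ t, U t b k (r + 1) = _ := fun t => (h t).new_first b k hbk'
  have edk : ∀ t, U t d k (r + 1) = _ := fun t => (h t).new_first d k hdk'
  by_cases h4 : i₂ = k
  · subst h4
    refine Agree.of_eq fun t => ?_
    simp only [eb, ed, ebk, edk, (h t).old_swap_left, (h t).old_swap_right, add_comm,
      add_left_comm, add_assoc]
  refine hu.lift h b i₁ d i₁ i₂ k (by constructor <;> (try constructor) <;> omega)
    (by constructor <;> (try constructor) <;> omega)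
    (fun _ => Finsupp.single (i₁, r + 1) 1 + Finsupp.single (i₂, r + 1) 1)
    (fun t => ?_) (fun t => ?_)
  · simp only [eb, edk, (h t).old_swap_left, (h t).old_swap_right, add_comm,
      add_left_comm, add_assoc]
  · simp only [ed, ebk, (h t).old_swap_left, (h t).old_swap_right, add_comm,
      add_left_comm, add_assoc]

lemma Uniform.agree_new_both (hu : Uniform r L V)
    (h : ∀ t, IsExtension r i₁ i₂ (i₃ t) (V t) (U t)) {b d j k : ℕ} (hb : Triple r b j k)
    (hd : Triple r d j k) :
    Agree (fun t => extend r i₁ i₂ (i₃ t) (L t))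
      (fun t => U t b j (r + 1) + U t d k (r + 1))
      (fun t => U t b k (r + 1) + U t d j (r + 1)) := by
  rcases isEmpty_or_nonempty ι with hι | ⟨⟨t₀⟩⟩
  · exact fun s => isEmptyElim s
  by_cases hbd : b = d
  · subst hbd
    exact Agree.of_eq fun t => add_comm _ _
  by_cases h1 : i₁ = b
  · subst h1
    exact hu.agree_new_both_of_eq_left h hb hd hbd
  by_cases h2 : i₁ = d
  · subst h2
    exact (hu.agree_new_both_of_eq_left h hd hb (Ne.symm hbd)).symm.congr
      (fun t => add_comm _ _) (fun t => add_comm _ _)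
  have hi₁ := (h t₀).triple.mem₁
  obtain ⟨hb₁, hj₁, hk₁, hbj, hbk, hjk⟩ := id hb
  obtain ⟨hd₁, -, -, hdj, hdk, -⟩ := id hd
  by_cases h3 : i₁ = j
  · subst h3
    exact hu.agree_new_both_of_eq_exchanged h hb hd hbd
  by_cases h4 : i₁ = k
  · subst h4
    exact (hu.agree_new_both_of_eq_exchanged h ⟨hb₁, hk₁, hj₁, hbk, hbj, hjk.symm⟩
      ⟨hd₁, hk₁, hj₁, hdk, hdj, hjk.symm⟩ hbd).symm
  refine hu.lift h b i₁ d i₁ j k (by constructor <;> (try constructor) <;> omega)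
    (by constructor <;> (try constructor) <;> omega)
    (fun _ => Finsupp.single (i₁, r + 1) 1 + Finsupp.single (i₁, r + 1) 1)
    (fun t => ?_) (fun t => ?_)
  · rw [(h t).new_first b j (by constructor <;> omega),
      (h t).new_first d k (by constructor <;> omega)]
    simp only [(h t).old_swap_right, add_left_comm, add_assoc]
  · rw [(h t).new_first b k (by constructor <;> omega),
      (h t).new_first d j (by constructor <;> omega)]
    simp only [(h t).old_swap_right, add_left_comm, add_assoc]

/-- The case of a new exchanged index, when the first new root meets both terms. -/
lemma Uniform.agree_new_exchanged_of_eq (hu : Uniform r L V)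
    (h : ∀ t, IsExtension r i₁ i₂ (i₃ t) (V t) (U t)) {b d k : ℕ} (hb : Triple r i₁ b k)
    (hd : Triple r i₁ d k) :
    Agree (fun t => extend r i₁ i₂ (i₃ t) (L t))
      (fun t => U t i₁ b (r + 1) + V t i₁ d k) (fun t => V t i₁ b k + U t i₁ d (r + 1)) := by
  rcases isEmpty_or_nonempty ι with hι | ⟨⟨t₀⟩⟩
  · exact fun s => isEmptyElim s
  by_cases hbd : b = d
  · subst hbd
    exact Agree.of_eq fun t => add_comm _ _
  have hi₂ := (h t₀).triple.mem₂
  have hi₁₂ := (h t₀).triple.ne₁₂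
  have hz₁ : ∀ t i, V t i₁ b k (i, r + 1) = 0 := fun t i => (h t).zero _ _ _ _ hb
  have hz₂ : ∀ t i, V t i₁ d k (i, r + 1) = 0 := fun t i => (h t).zero _ _ _ _ hd
  obtain ⟨ha₁, hb₁, hk₁, hab, hak, hbk⟩ := hb
  obtain ⟨-, hd₁, -, had, -, hdk⟩ := hd
  by_cases h1 : i₂ = b
  · subst h1
    refine Agree.of_lt_second (fun t => ?_) (fun t => ?_)
    · simp [(h t).eval_first_zero, *]
    · simp [hz₁, hz₂, (h t).eval_third,
        (h t).eval_second_one (b := d) (by constructor <;> omega)]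
  by_cases h2 : i₂ = d
  · subst h2
    refine (Agree.of_lt_second (fun t => ?_) (fun t => ?_)).symm
    · simp [(h t).eval_first_zero, *]
    · simp [hz₁, hz₂, (h t).eval_third,
        (h t).eval_second_one (b := b) (by constructor <;> omega)]
  have eb : ∀ t, U t i₁ b (r + 1) = _ := fun t => (h t).new_second b (by constructor <;> omega)
  have ed : ∀ t, U t i₁ d (r + 1) = _ := fun t => (h t).new_second d (by constructor <;> omega)
  by_cases h3 : i₂ = k
  · subst h3
    refine Agree.of_eq fun t => ?_
    simp only [eb, ed, add_left_comm, add_assoc]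
  refine hu.lift h i₁ b i₁ d i₂ k (by constructor <;> (try constructor) <;> omega)
    (by constructor <;> (try constructor) <;> omega) (fun _ => Finsupp.single (i₂, r + 1) 1)
    (fun t => ?_) (fun t => ?_)
  · rw [eb, add_assoc]
  · rw [ed, add_left_comm]

lemma Uniform.agree_new_exchanged (hu : Uniform r L V)
    (h : ∀ t, IsExtension r i₁ i₂ (i₃ t) (V t) (U t)) {a b c d k : ℕ} (hab : Triple r a b k)
    (hcd : Triple r c d k) :
    Agree (fun t => extend r i₁ i₂ (i₃ t) (L t))
      (fun t => U t a b (r + 1) + V t c d k) (fun t => V t a b k + U t c d (r + 1)) := by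
  rcases isEmpty_or_nonempty ι with hι | ⟨⟨t₀⟩⟩
  · exact fun s => isEmptyElim s
  have hz₁ : ∀ t i, V t a b k (i, r + 1) = 0 := fun t i => (h t).zero _ _ _ _ hab
  have hz₂ : ∀ t i, V t c d k (i, r + 1) = 0 := fun t i => (h t).zero _ _ _ _ hcd
  have hi₁ := (h t₀).triple.mem₁
  obtain ⟨ha₁, hb₁, hk₁, hne₁, hak, hbk⟩ := id hab
  obtain ⟨hc₁, hd₁, -, hne₂, hck, hdk⟩ := id hcd
  have one : ∀ {x y : ℕ}, 1 ≤ x ∧ x ≤ r → 1 ≤ y ∧ y ≤ r → x ≠ y → ¬ (i₁ = x ∨ i₁ = y) →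
      ∀ t, U t x y (r + 1) (i₁, r + 1) = 1 := fun hx hy hxy hn t =>
    (h t).eval_first_one (by constructor <;> omega)
  have zero : ∀ {x y : ℕ}, 1 ≤ x ∧ x ≤ r → 1 ≤ y ∧ y ≤ r → x ≠ y → (i₁ = x ∨ i₁ = y) →
      ∀ t, U t x y (r + 1) (i₁, r + 1) = 0 := by
    rintro x y hx hy hxy (rfl | rfl) t
    · exact (h t).eval_first_zero hy hxy
    · exact (h t).eval_first_zero' hx hxy.symm
  by_cases h1 : i₁ = a ∨ i₁ = b
  · by_cases h2 : i₁ = c ∨ i₁ = d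
    · rcases h1 with rfl | rfl <;> rcases h2 with rfl | rfl
      · exact hu.agree_new_exchanged_of_eq h hab hcd
      · refine (hu.agree_new_exchanged_of_eq h (d := c) hab (by constructor <;> omega)).congr
          (fun t => ?_) (fun t => ?_)
        · rw [(h t).old_swap_left c]
        · rw [(h t).swap_left c]
      · refine (hu.agree_new_exchanged_of_eq h (b := a) (by constructor <;> omega) hcd).congr
          (fun t => ?_) (fun t => ?_)
        · rw [(h t).swap_left a]
        · rw [(h t).old_swap_left a]
      · refine (hu.agree_new_exchanged_of_eq h (b := a) (d := c) (k := k)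
          (by constructor <;> omega) (by constructor <;> omega)).congr (fun t => ?_) (fun t => ?_)
        · rw [(h t).swap_left a, (h t).old_swap_left c]
        · rw [(h t).old_swap_left a, (h t).swap_left c]
    · refine Agree.of_lt_first fun t => ?_
      simp [hz₁, hz₂, zero ha₁ hb₁ hne₁ h1, one hc₁ hd₁ hne₂ h2]
  · by_cases h2 : i₁ = c ∨ i₁ = d
    · refine (Agree.of_lt_first fun t => ?_).symm
      simp [hz₁, hz₂, one ha₁ hb₁ hne₁ h1, zero hc₁ hd₁ hne₂ h2]
    have eab : ∀ t, U t a b (r + 1) = _ := fun t => (h t).new_first a b (by constructor <;> omega)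
    have ecd : ∀ t, U t c d (r + 1) = _ := fun t => (h t).new_first c d (by constructor <;> omega)
    by_cases h3 : i₁ = k
    · subst h3
      refine Agree.of_eq fun t => ?_
      simp only [eab, ecd, add_left_comm, add_assoc]
    refine hu.lift h a b c d i₁ k (by constructor <;> (try constructor) <;> omega)
      (by constructor <;> (try constructor) <;> omega) (fun _ => Finsupp.single (i₁, r + 1) 1)
      (fun t => ?_) (fun t => ?_)
    · rw [eab, add_assoc]
    · rw [ecd, add_left_comm]

lemma Uniform.agree_of_new_left (hu : Uniform r L V)
    (h : ∀ t, IsExtension r i₁ i₂ (i₃ t) (V t) (U t)) {b c d j k : ℕ}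
    (hb : Quad (r + 1) (r + 1) b j k) (hcd : Quad (r + 1) c d j k) :
    Agree (fun t => extend r i₁ i₂ (i₃ t) (L t))
      (fun t => U t (r + 1) b j + U t c d k) (fun t => U t (r + 1) b k + U t c d j) := by
  obtain ⟨⟨-, hb₁, hj₁, hbN, hjN, hbj⟩, ⟨-, -, hk₁, -, hkN, hbk⟩, hjk⟩ := hb
  obtain ⟨⟨hc₁, hd₁, -, hcd, hcj, hdj⟩, ⟨-, -, -, -, hck, hdk⟩, -⟩ := hcd
  have new : ∀ t x y, U t (r + 1) x y = U t x y (r + 1) := fun t x y => by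
    rw [(h t).swap_left, (h t).swap_right]
  by_cases h1 : c = r + 1
  · subst h1
    refine (hu.agree_new_both h (b := b) (d := d) (j := j) (k := k) (by constructor <;> omega)
      (by constructor <;> omega)).congr (fun t => ?_) (fun t => ?_) <;> simp only [new]
  by_cases h2 : d = r + 1
  · subst h2
    refine (hu.agree_new_both h (b := b) (d := c) (j := j) (k := k) (by constructor <;> omega)
      (by constructor <;> omega)).congr (fun t => ?_) (fun t => ?_) <;>
    simp only [new, (h t).swap_left c]
  refine (hu.agree_new_left h (b := b) (c := c) (d := d) (j := j) (k := k)
    (by constructor <;> omega) (by constructor <;> (try constructor) <;> omega)).congr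
    (fun t => ?_) (fun t => ?_)
  · rw [new, (h t).old c d k (by constructor <;> omega)]
  · rw [new, (h t).old c d j (by constructor <;> omega)]

lemma Uniform.agree_of_new_exchanged (hu : Uniform r L V)
    (h : ∀ t, IsExtension r i₁ i₂ (i₃ t) (V t) (U t)) {a b c d k : ℕ}
    (hab : Quad (r + 1) a b (r + 1) k) (hcd : Quad (r + 1) c d (r + 1) k) :
    Agree (fun t => extend r i₁ i₂ (i₃ t) (L t))
      (fun t => U t a b (r + 1) + U t c d k) (fun t => U t a b k + U t c d (r + 1)) := by
  obtain ⟨⟨ha₁, hb₁, -, hab, haN, hbN⟩, ⟨-, -, hk₁, -, hak, hbk⟩, hjk⟩ := hab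
  obtain ⟨⟨hc₁, hd₁, -, hcd, hcN, hdN⟩, ⟨-, -, -, -, hck, hdk⟩, -⟩ := hcd
  have h1 : Triple r a b k := by constructor <;> omega
  have h2 : Triple r c d k := by constructor <;> omega
  refine (hu.agree_new_exchanged h h1 h2).congr (fun t => ?_) (fun t => ?_)
  · rw [(h t).old c d k h2]
  · rw [(h t).old a b k h1]

lemma Triple.swap {r a b c : ℕ} (h : Triple r a b c) : Triple r b a c :=
  ⟨h.mem₂, h.mem₁, h.mem₃, h.ne₁₂.symm, h.ne₂₃, h.ne₁₃⟩

lemma Quad.swap_left {r a b j k : ℕ} (h : Quad r a b j k) : Quad r b a j k :=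
  ⟨h.left.swap, h.right.swap, h.ne⟩

lemma Quad.swap_right {r a b j k : ℕ} (h : Quad r a b j k) : Quad r a b k j :=
  ⟨h.right, h.left, h.ne.symm⟩

lemma Triple.restrict {r a b c : ℕ} (h : Triple (r + 1) a b c) (ha : a ≠ r + 1)
    (hb : b ≠ r + 1) (hc : c ≠ r + 1) : Triple r a b c := by
  obtain ⟨h1, h2, h3, h4, h5, h6⟩ := h
  constructor <;> omega

lemma Quad.restrict {r a b j k : ℕ} (h : Quad (r + 1) a b j k) (ha : a ≠ r + 1)
    (hb : b ≠ r + 1) (hj : j ≠ r + 1) (hk : k ≠ r + 1) : Quad r a b j k :=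
  ⟨h.left.restrict ha hb hj, h.right.restrict ha hb hk, h.ne⟩

lemma Uniform.extend (hu : Uniform r L V)
    (h : ∀ t, IsExtension r i₁ i₂ (i₃ t) (V t) (U t)) :
    Uniform (r + 1) (fun t => extend r i₁ i₂ (i₃ t) (L t)) U := by
  intro a b c d j k hab hcd
  by_cases h1 : a = r + 1
  · subst h1
    exact hu.agree_of_new_left h hab hcd
  by_cases h2 : b = r + 1
  · subst h2
    exact (hu.agree_of_new_left h hab.swap_left hcd).congr
      (fun t => by rw [(h t).swap_left a]) (fun t => by rw [(h t).swap_left a])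
  by_cases h3 : c = r + 1
  · subst h3
    exact (hu.agree_of_new_left h hcd.swap_right hab.swap_right).congr
      (fun t => add_comm _ _) (fun t => add_comm _ _)
  by_cases h4 : d = r + 1
  · subst h4
    exact (hu.agree_of_new_left h hcd.swap_left.swap_right hab.swap_right).congr
      (fun t => by rw [(h t).swap_left c, add_comm]) (fun t => by rw [(h t).swap_left c, add_comm])
  by_cases h5 : j = r + 1
  · subst h5
    exact hu.agree_of_new_exchanged h hab hcd
  by_cases h6 : k = r + 1
  · subst h6
    exact (hu.agree_of_new_exchanged h hab.swap_right hcd.swap_right).symm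
  have hab' := hab.restrict h1 h2 h5 h6
  have hcd' := hcd.restrict h3 h4 h5 h6
  refine hu.lift h a b c d j k hab' hcd' (fun _ => 0) (fun t => ?_) (fun t => ?_)
  · rw [(h t).old _ _ _ hab'.left, (h t).old _ _ _ hcd'.right, zero_add]
  · rw [(h t).old _ _ _ hab'.right, (h t).old _ _ _ hcd'.left, zero_add]

end Compare

/-! ### Families of sequences that differ only in irrelevant choices -/

/-- A family of iterated sequences with the same first two entries in each prepended triple. -/
inductive Parallel {ι : Type*} : ℕ → (ι → List (ℕ × ℕ)) → Prop
  | base (P : ι → List (ℕ × ℕ)) : (∀ t, (P t).Perm [(1, 4), (2, 4), (3, 4)]) → Parallel 4 P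
  | step (r i₁ i₂ : ℕ) (i₃ : ι → ℕ) (P : ι → List (ℕ × ℕ)) : 4 ≤ r →
      (∀ t, Triple r i₁ i₂ (i₃ t)) → Parallel r P →
      Parallel (r + 1) fun t => extend r i₁ i₂ (i₃ t) (P t)

section Parallel

variable {ι : Type*} {n r : ℕ} {P : ι → List (ℕ × ℕ)}

lemma Parallel.isIter (h : Parallel r P) (t : ι) : IsIter r (P t) := by
  induction h with
  | base P hP => exact .base _ (hP t)
  | step r i₁ i₂ i₃ P hr hi _ ih =>
    obtain ⟨h1, h2, h3, h4, h5, h6⟩ := hi t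
    exact .step r (P t) i₁ i₂ (i₃ t) hr ih h1.1 h1.2 h2.1 h2.2 h3.1 h3.2 h4 h5 h6

lemma exists_extend_of_perm {S : List (ℕ × ℕ)} (h : S.Perm [(1, 4), (2, 4), (3, 4)]) :
    ∃ i₁ i₂ i₃, Triple 3 i₁ i₂ i₃ ∧ S = extend 3 i₁ i₂ i₃ [] := by
  rw [← List.mem_permutations] at h
  simp [List.permutations, List.permutationsAux, List.permutationsAux.rec] at h
  rcases h with h | h | h | h | h | h <;> subst h <;>
    exact ⟨_, _, _, by constructor <;> omega, rfl⟩

lemma Parallel.described (h : Parallel r P) (hr : r ≤ n) (t : ι) : Described n r (P t) := by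
  induction h with
  | base P hP =>
    obtain ⟨i₁, i₂, i₃, hi, hS⟩ := exists_extend_of_perm (hP t)
    rw [hS]
    exact (Described.nil n).extend hi hr
  | step r i₁ i₂ i₃ P _ hi _ ih => exact (ih (by omega)).extend (hi t) hr

lemma Parallel.uniform (h : Parallel r P) (hr : r ≤ n) : Uniform r P fun t => W n (P t) := by
  induction h with
  | base P hP =>
    intro a b c d j k hab hcd
    obtain ⟨⟨ha₁, hb₁, hj₁, hab, haj, hbj⟩, ⟨-, -, hk₁, -, hak, hbk⟩, hjk⟩ := hab
    obtain ⟨⟨hc₁, hd₁, -, hcd, hcj, hdj⟩, ⟨-, -, -, -, hck, hdk⟩, -⟩ := hcd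
    have key : a = c ∧ b = d ∨ a = d ∧ b = c := by omega
    refine Agree.of_eq fun t => ?_
    rcases key with ⟨rfl, rfl⟩ | ⟨rfl, rfl⟩
    · exact add_comm _ _
    · simp only [W_swap_left n _ a b, add_comm]
  | step r i₁ i₂ i₃ P _ hi hP ih =>
    exact (ih (by omega)).extend fun t => (hP.described (by omega) t).isExtension (hi t) hr

end Parallel

/-! ### Initial forms of the Plücker relations -/

section Initial

variable {ι : Type*} {n : ℕ} {S : List (ℕ × ℕ)} {l : List ℕ} {a b c : ℕ}

lemma W_perm {a' b' c' : ℕ} (h : [a', b', c'].Perm [a, b, c]) : W n S a' b' c' = W n S a b c := by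
  rw [← List.mem_permutations] at h
  simp [List.permutations, List.permutationsAux, List.permutationsAux.rec] at h
  rcases h with h | h | h | h | h | h <;> obtain ⟨rfl, rfl, rfl⟩ := h
  · rfl
  · rw [W_swap_left]
  · rw [W_swap_right, W_swap_left, W_swap_right]
  · rw [W_swap_right, W_swap_left]
  · rw [W_swap_left, W_swap_right]
  · rw [W_swap_right]

lemma valS_getD_of_perm (h : l.Perm [a, b, c]) :
    valS n S (fun x : Fin 3 => l.getD x 0) = W n S a b c := by
  obtain ⟨x, y, z, rfl⟩ := List.length_eq_three.1 h.length_eq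
  rw [← W_perm h]
  congr 1
  ext i
  fin_cases i <;> rfl

lemma Triple.of_sorted (h : l.Perm [a, b, c]) (hs : Sorted 3 n fun x : Fin 3 => l.getD x 0) :
    Triple n a b c := by
  obtain ⟨x, y, z, rfl⟩ := List.length_eq_three.1 h.length_eq
  have hxy : x < y := hs.1 (show (0 : Fin 3) < 1 by decide)
  have hyz : y < z := hs.1 (show (1 : Fin 3) < 2 by decide)
  have hd : [a, b, c].Nodup := h.nodup_iff.1 (by simp; omega)
  have hm : ∀ w ∈ [a, b, c], 1 ≤ w ∧ w ≤ n := by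
    intro w hw
    have hw' := h.mem_iff.2 hw
    simp at hw'
    rcases hw' with rfl | rfl | rfl
    exacts [hs.2 0, hs.2 1, hs.2 2]
  simp at hd hm
  constructor <;> omega

lemma insert3_perm (I : Fin 2 → ℕ) (j : ℕ) :
    (List.insertionSort (· ≤ ·) [I 0, I 1, j]).Perm [I 0, I 1, j] :=
  List.perm_insertionSort _ _

lemma erase4_perm (J : Fin 4 → ℕ) {x p q y : Fin 4} (h : [0, 1, 2, 3].Perm [x, p, q, y]) :
    ([J 0, J 1, J 2, J 3].erase (J x)).Perm [J p, J q, J y] := by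
  have h' := (h.map J).erase (J x)
  simpa using h'

lemma mem_support_Rrel {I : Fin 2 → ℕ} {J : Fin 4 → ℕ} {m : MI n →₀ ℕ}
    (hm : m ∈ (Rrel n I J).support) :
    ∃ x : Fin 4, ∃ (h₁ : Sorted 3 n (insert3 I (J x))) (h₂ : Sorted 3 n (erase4 J (J x))),
      m = Finsupp.single ⟨_, h₁⟩ 1 + Finsupp.single ⟨_, h₂⟩ 1 := by
  classical
  rw [mem_support_iff, Rrel, coeff_sum] at hm
  obtain ⟨x, -, hx⟩ := Finset.exists_ne_zero_of_sum_ne_zero hm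
  refine ⟨x, ?_⟩
  set k := (Finset.univ.filter fun b : Fin 2 => I b < J x).card +
    (Finset.univ.filter fun b : Fin 4 => J x < J b).card
  have hC : (-1 : PRing n) ^ k = C ((-1) ^ k) := by simp
  rw [hC, coeff_C_mul] at hx
  have hx' := right_ne_zero_of_mul hx
  unfold pvar at hx'
  split_ifs at hx' with h₁ h₂
  · refine ⟨h₁, h₂, ?_⟩
    rw [X, X, monomial_mul, coeff_monomial] at hx'
    by_contra hne
    exact hx' (if_neg (Ne.symm hne))
  all_goals simp at hx'

lemma MSdot_term (K₁ K₂ : MI n) :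
    MSdot n S (Finsupp.single K₁ 1 + Finsupp.single K₂ 1) = valS n S K₁ + valS n S K₂ := by
  classical
  rw [MSdot, Finsupp.sum_add_index' (by simp) (by simp [add_smul])]
  simp

lemma Described.Psi_W (h : Described n n S) (ht : Triple n a b c) :
    Psi (W n S a b c) + 6 = a + b + c :=
  (h.coord a b c ht).psi _ (h.coord a b c ht).lead.1

lemma psiLE_iff_lexLE {X Y : (ℕ × ℕ) →₀ ℕ} (h : Psi X = Psi Y) :
    psiLE S X Y ↔ lexLE S Y X := by
  simp [psiLE, h]

lemma exists_complement : ∀ x y : Fin 4, x ≠ y → ∃ p q : Fin 4,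
    [0, 1, 2, 3].Perm [x, p, q, y] ∧ [0, 1, 2, 3].Perm [y, p, q, x] := by
  decide

lemma Parallel.psiLE_MSdot {P : ι → List (ℕ × ℕ)} (hP : Parallel n P) (s t : ι)
    {I : Fin 2 → ℕ} {J : Fin 4 → ℕ} {m m' : MI n →₀ ℕ} (hm : m ∈ (Rrel n I J).support)
    (hm' : m' ∈ (Rrel n I J).support) (h : psiLE (P s) (MSdot n (P s) m) (MSdot n (P s) m')) :
    psiLE (P t) (MSdot n (P t) m) (MSdot n (P t) m') := by
  obtain ⟨x, hx₁, hx₂, rfl⟩ := mem_support_Rrel hm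
  obtain ⟨y, hy₁, hy₂, rfl⟩ := mem_support_Rrel hm'
  by_cases hxy : x = y
  · subst hxy
    exact Or.inr ⟨rfl, lexLE_refl _ _⟩
  obtain ⟨p, q, hp, hp'⟩ : ∃ p q : Fin 4, [0, 1, 2, 3].Perm [x, p, q, y] ∧
      [0, 1, 2, 3].Perm [y, p, q, x] :=
    exists_complement x y hxy
  have tx₁ := Triple.of_sorted (insert3_perm I (J x)) hx₁
  have ty₁ := Triple.of_sorted (insert3_perm I (J y)) hy₁
  have tx₂ := Triple.of_sorted (erase4_perm J hp) hx₂
  have ty₂ := Triple.of_sorted (erase4_perm J hp') hy₂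
  have hx : ∀ s, MSdot n (P s) (Finsupp.single ⟨_, hx₁⟩ 1 + Finsupp.single ⟨_, hx₂⟩ 1) =
      W n (P s) (I 0) (I 1) (J x) + W n (P s) (J p) (J q) (J y) := fun s => by
    rw [MSdot_term]
    exact congrArg₂ _ (valS_getD_of_perm (insert3_perm I (J x)))
      (valS_getD_of_perm (erase4_perm J hp))
  have hy : ∀ s, MSdot n (P s) (Finsupp.single ⟨_, hy₁⟩ 1 + Finsupp.single ⟨_, hy₂⟩ 1) =
      W n (P s) (I 0) (I 1) (J y) + W n (P s) (J p) (J q) (J x) := fun s => by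
    rw [MSdot_term]
    exact congrArg₂ _ (valS_getD_of_perm (insert3_perm I (J y)))
      (valS_getD_of_perm (erase4_perm J hp'))
  have hPsi : ∀ s, Psi (W n (P s) (I 0) (I 1) (J x) + W n (P s) (J p) (J q) (J y)) =
      Psi (W n (P s) (I 0) (I 1) (J y) + W n (P s) (J p) (J q) (J x)) := fun s => by
    have hd := hP.described le_rfl s
    have h1 := hd.Psi_W tx₁
    have h2 := hd.Psi_W ty₁
    have h3 := hd.Psi_W tx₂
    have h4 := hd.Psi_W ty₂
    rw [Psi_add, Psi_add]
    omega
  rw [hx, hy, psiLE_iff_lexLE (hPsi _)] at h ⊢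
  by_cases hJ : J x = J y
  · rw [hJ]
    exact lexLE_refl _ _
  have key := hP.uniform le_rfl _ _ _ _ _ _ ⟨tx₁, ty₁, hJ⟩ ⟨ty₂, tx₂, hJ⟩
  exact (key s t).2 h

lemma Parallel.inM_Rrel {P : ι → List (ℕ × ℕ)} (hP : Parallel n P) (s t : ι)
    (I : Fin 2 → ℕ) (J : Fin 4 → ℕ) : inM n (P s) (Rrel n I J) = inM n (P t) (Rrel n I J) := by
  classical
  refine Finset.sum_congr (Finset.ext fun m => ?_) fun _ _ => rfl
  simp only [Finset.mem_filter]
  refine and_congr_right fun hm => forall₂_congr fun m' hm' => ?_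
  exact ⟨hP.psiLE_MSdot s t hm hm', hP.psiLE_MSdot t s hm hm'⟩

end Initial

/-! ### Counting the families -/

/-- An element of `{1, 2, 3}` different from `a` and `b`. -/
def third (a b : ℕ) : ℕ :=
  if a ≠ 1 ∧ b ≠ 1 then 1 else if a ≠ 2 ∧ b ≠ 2 then 2 else 3

lemma third_spec (a b : ℕ) : a ≠ third a b ∧ b ≠ third a b ∧ 1 ≤ third a b ∧ third a b ≤ 3 := by
  unfold third
  split_ifs <;> omega

lemma exists_representatives (r : ℕ) : ∃ F : Finset (List (ℕ × ℕ)),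
    F.card ≤ ∏ l ∈ Finset.range r, (r + 4 - l - 1) * (r + 4 - l - 2) ∧
    ∀ S, IsIter (r + 4) S →
      ∃ P : Bool → List (ℕ × ℕ), Parallel (r + 4) P ∧ P true = S ∧ P false ∈ F := by
  classical
  induction r with
  | zero =>
    refine ⟨{[(1, 4), (2, 4), (3, 4)]}, by simp, fun S hS => ?_⟩
    cases hS with
    | base L hL =>
      refine ⟨fun t => if t then S else [(1, 4), (2, 4), (3, 4)], .base _ fun t => ?_, ?_, ?_⟩
      · cases t
        · simp
        · simpa using hL
      · simp
      · simp
    | step r L _ _ _ hr => omega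
  | succ r ih =>
    obtain ⟨F, hF, hrep⟩ := ih
    refine ⟨((Finset.Icc 1 (r + 4)).offDiag ×ˢ F).image fun p =>
      extend (r + 4) p.1.1 p.1.2 (third p.1.1 p.1.2) p.2, ?_, fun S hS => ?_⟩
    · refine Finset.card_image_le.trans ?_
      rw [Finset.card_product, Finset.offDiag_card, Nat.card_Icc, Finset.prod_range_succ', mul_comm]
      refine Nat.mul_le_mul (hF.trans (Finset.prod_le_prod' fun l _ => ?_)) ?_
      · exact Nat.mul_le_mul (by omega) (by omega)
      · rw [← Nat.mul_sub_one]
        exact Nat.mul_le_mul (by omega) (by omega)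
    · generalize hN : r + 1 + 4 = N at hS
      cases hS with
      | base L hL => omega
      | step r' L i₁ i₂ i₃ hr hL h1 h2 h3 h4 h5 h6 h7 h8 h9 =>
        obtain rfl : r' = r + 4 := by omega
        obtain ⟨P, hP, rfl, hPF⟩ := hrep L hL
        refine ⟨fun t => extend (r + 4) i₁ i₂ (if t then i₃ else third i₁ i₂) (P t),
          .step _ i₁ i₂ _ P hr (fun t => ?_) hP, by simp, ?_⟩
        · have := third_spec i₁ i₂
          cases t <;> simp only [Bool.false_eq_true, if_true, if_false] <;> constructor <;> omega
        · refine Finset.mem_image.2 ⟨((i₁, i₂), P false), ?_, by simp⟩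
          simp [hPF]
          omega

end IteratedSeq

/-- If for every iterated sequence `S` for `Gr(3,n)` the nonzero Plücker relations form a
Gröbner basis of the Plücker ideal with respect to `M_S`, then the number of distinct
initial ideals `In_{M_S}(𝓘_{3,n})` is at most `∏_{l=0}^{n-5} (n-l-1)(n-l-2)`. -/
theorem number_of_initial_ideals_le (n : ℕ) (hn : 5 ≤ n)
    (hGB : ∀ S : List (ℕ × ℕ), IsIter n S → InIdeal n S =
      Ideal.span {g | ∃ I J, Sorted 2 n I ∧ Sorted 4 n J ∧ Rrel n I J ≠ 0 ∧
        g = inM n S (Rrel n I J)}) :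
    {X : Ideal (PRing n) | ∃ S, IsIter n S ∧ X = InIdeal n S}.Finite ∧
    {X : Ideal (PRing n) | ∃ S, IsIter n S ∧ X = InIdeal n S}.ncard ≤
      ∏ l ∈ Finset.range (n - 4), (n - l - 1) * (n - l - 2) := by
  obtain ⟨F, hF, hrep⟩ := IteratedSeq.exists_representatives (n - 4)
  rw [Nat.sub_add_cancel (by omega)] at hF hrep
  have hsub : {X : Ideal (PRing n) | ∃ S, IsIter n S ∧ X = InIdeal n S} ⊆ InIdeal n '' F := by
    rintro _ ⟨S, hS, rfl⟩
    obtain ⟨P, hP, rfl, hPF⟩ := hrep S hS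
    refine ⟨P false, hPF, ?_⟩
    rw [hGB _ (hP.isIter false), hGB _ (hP.isIter true)]
    simp only [hP.inM_Rrel false true]
  have hfin : (InIdeal n '' (F : Set (List (ℕ × ℕ)))).Finite := F.finite_toSet.image _
  refine ⟨hfin.subset hsub, (Set.ncard_le_ncard hsub hfin).trans ?_⟩
  exact ((Set.ncard_image_le F.finite_toSet).trans (Set.ncard_coe_finset F).le).trans hF
end
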